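/- arXiv:1404.6647 — 6 statements merged into one kernel-verified Lean document; each statement's English description precedes it below -/
import Mathlib

section
/- Let 𝔣 be an additive, κ-Lipschitz graph parameter. Then for any n ≥ 1 and any two degree functions d, d' : {1,…,n} → ℕ, |E[𝔣(𝔾_d)] − E[𝔣(𝔾_{d'})]| ≤ 2κ·Σ_{i=1}^n |d(i) − d'(i)|. -/
open Finset Filter Topology MeasureTheory
open scoped Classical BigOperators ENNReal

structure Multigraph where
  (V : Type)
  [fintypeV : Fintype V]
  (edges : Multiset (Sym2 V))

attribute [instance] Multigraph.fintypeV

def Multigraph.addEdge (G : Multigraph) (i j : G.V) : Multigraph :=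
  { V := G.V, edges := s(i, j) ::ₘ G.edges }

def Multigraph.disjUnion (G₁ G₂ : Multigraph) : Multigraph :=
  { V := G₁.V ⊕ G₂.V,
    edges := G₁.edges.map (Sym2.map Sum.inl) + G₂.edges.map (Sym2.map Sum.inr) }

/-- A graph parameter is invariant under graph isomorphism. -/
def GraphParam.Invariant (f : Multigraph → ℝ) : Prop :=
  ∀ (G₁ G₂ : Multigraph) (e : G₁.V ≃ G₂.V),
    G₂.edges = G₁.edges.map (Sym2.map e) → f G₁ = f G₂

def GraphParam.Additive (f : Multigraph → ℝ) : Prop :=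
  ∀ G₁ G₂ : Multigraph, f (G₁.disjUnion G₂) = f G₁ + f G₂

def GraphParam.Lipschitz (f : Multigraph → ℝ) (κ : ℝ) : Prop :=
  ∀ (G : Multigraph) (i j : G.V), |f (G.addEdge i j) - f G| ≤ κ

def GraphParam.Concave (f : Multigraph → ℝ) : Prop :=
  ∀ (G : Multigraph) (x : G.V → ℝ), (∑ i, x i) = 0 →
    ∑ i, ∑ j, (f (G.addEdge i j) - f G) * x i * x j ≤ 0

abbrev HalfEdge (V : Type) (d : V → ℕ) : Type := Σ i : V, Fin (d i)

def IsPairMatching {α : Type} (m : Finset (Sym2 α)) : Prop :=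
  (∀ p ∈ m, ¬ p.IsDiag) ∧
    ∀ p ∈ m, ∀ q ∈ m, p ≠ q → ∀ h : α, h ∈ p → h ∉ q

def IsMaximalMatching {α : Type} (m : Finset (Sym2 α)) : Prop :=
  IsPairMatching m ∧ ∀ m' : Finset (Sym2 α), IsPairMatching m' → m ⊆ m' → m' = m

/-- The multigraph `G[m]` induced on `V` by a matching `m` of the half-edges. -/
def matchingGraph (V : Type) [Fintype V] (d : V → ℕ)
    (m : Finset (Sym2 (HalfEdge V d))) : Multigraph :=
  { V := V, edges := m.val.map (Sym2.map Sigma.fst) }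

noncomputable def maximalMatchings (V : Type) [Fintype V] [DecidableEq V] (d : V → ℕ) :
    Finset (Finset (Sym2 (HalfEdge V d))) :=
  Finset.univ.filter fun m => IsMaximalMatching m

/-- `E[f(𝔾_d)]`: expectation of `f` under the configuration model with degrees `d`. -/
noncomputable def configExpect (V : Type) [Fintype V] [DecidableEq V] (d : V → ℕ)
    (f : Multigraph → ℝ) : ℝ :=
  (∑ m ∈ maximalMatchings V d, f (matchingGraph V d m)) / ((maximalMatchings V d).card : ℝ)

/-- `E[f(𝔾^iid_{μ,n})]`. -/
noncomputable def iidExpect (μ : ℕ → ℝ) (n : ℕ) (f : Multigraph → ℝ) : ℝ :=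
  ∑' D : Fin n → ℕ, (∏ i, μ (D i)) * configExpect (Fin n) D f

noncomputable def tailSum (μ : ℕ → ℝ) (i : ℕ) : ℝ := ∑' k : ℕ, if i ≤ k then μ k else 0

/-- The Wasserstein distance `W(μ, μ') = Σ_{i≥1} |Σ_{k≥i} (μ k - μ' k)|`. -/
noncomputable def wasserstein (μ μ' : ℕ → ℝ) : ℝ :=
  ∑' i : ℕ, |tailSum μ (i + 1) - tailSum μ' (i + 1)|

/-- Empirical degree distribution of `d : Fin n → ℕ`. -/
noncomputable def empirical (n : ℕ) (d : Fin n → ℕ) : ℕ → ℝ :=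
  fun k => ((Finset.univ.filter fun i => d i = k).card : ℝ) / (n : ℝ)

/-- The degree sequences `d n` approach the degree distribution `μ` (with mean `Σ k·μ(k)`). -/
def Approaches (d : (n : ℕ) → Fin n → ℕ) (μ : ℕ → ℝ) : Prop :=
  (∀ k : ℕ, Tendsto (fun n => empirical n (d n) k) atTop (nhds (μ k))) ∧
    Tendsto (fun n => (∑ i, (d n i : ℝ)) / (n : ℝ)) atTop
      (nhds (∑' k : ℕ, (k : ℝ) * μ k))


lemma avg_bound {X Y Z : Type} (A : Finset X) (B : Finset Y) (C : Finset Z) (hC : C.Nonempty)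
    (φ : X → Z → Y) (F : X → ℝ) (G : Y → ℝ) (c : ℝ) (hc : 0 ≤ c)
    (hmem : ∀ a ∈ A, ∀ z ∈ C, φ a z ∈ B)
    (hinj : ∀ a ∈ A, ∀ z ∈ C, ∀ a' ∈ A, ∀ z' ∈ C, φ a z = φ a' z' → a = a' ∧ z = z')
    (hsurj : ∀ b ∈ B, ∃ a ∈ A, ∃ z ∈ C, φ a z = b)
    (hb : ∀ a ∈ A, ∀ z ∈ C, |G (φ a z) - F a| ≤ c) :
    |(∑ b ∈ B, G b) / (B.card : ℝ) - (∑ a ∈ A, F a) / (A.card : ℝ)| ≤ c := by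
  have key : ∀ {M : Type} [AddCommMonoid M] (G : Y → M),
      ∑ b ∈ B, G b = ∑ x ∈ A ×ˢ C, G (φ x.1 x.2) := by
    intro M _ G
    symm
    refine Finset.sum_bij (fun x _ => φ x.1 x.2) ?_ ?_ ?_ ?_
    · intro x hx
      rw [Finset.mem_product] at hx
      exact hmem _ hx.1 _ hx.2
    · intro x hx y hy h
      rw [Finset.mem_product] at hx hy
      obtain ⟨h1, h2⟩ := hinj _ hx.1 _ hx.2 _ hy.1 _ hy.2 h
      exact Prod.ext h1 h2
    · intro b hb
      obtain ⟨a, ha, z, hz, rfl⟩ := hsurj b hb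
      exact ⟨(a, z), Finset.mem_product.2 ⟨ha, hz⟩, rfl⟩
    · intros; rfl
  have hcard : B.card = A.card * C.card := by
    have := key (M := ℕ) (fun _ => 1)
    simpa using this
  have hs := key G
  rw [Finset.sum_product] at hs
  rcases A.eq_empty_or_nonempty with rfl | hA
  · simp at hs hcard
    simp [hcard, hc]
  have hA' : (0 : ℝ) < A.card := by exact_mod_cast hA.card_pos
  have hC' : (0 : ℝ) < C.card := by exact_mod_cast hC.card_pos
  have e : (∑ b ∈ B, G b) / (B.card : ℝ) - (∑ a ∈ A, F a) / (A.card : ℝ)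
      = (∑ a ∈ A, ∑ z ∈ C, (G (φ a z) - F a)) / (A.card * C.card) := by
    rw [hcard, hs]
    simp only [Finset.sum_sub_distrib, Finset.sum_const, nsmul_eq_mul, ← Finset.mul_sum]
    push_cast
    field_simp
  rw [e, abs_div, abs_of_pos (mul_pos hA' hC'), div_le_iff₀ (mul_pos hA' hC')]
  calc |∑ a ∈ A, ∑ z ∈ C, (G (φ a z) - F a)| ≤ ∑ a ∈ A, |∑ z ∈ C, (G (φ a z) - F a)| :=
        Finset.abs_sum_le_sum_abs _ _
    _ ≤ ∑ a ∈ A, ∑ z ∈ C, |G (φ a z) - F a| :=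
        Finset.sum_le_sum fun a _ => Finset.abs_sum_le_sum_abs _ _
    _ ≤ ∑ a ∈ A, ∑ z ∈ C, c :=
        Finset.sum_le_sum fun a ha => Finset.sum_le_sum fun z hz => hb a ha z hz
    _ = c * (A.card * C.card) := by simp; ring

def Unm {α : Type} (m : Finset (Sym2 α)) (x : α) : Prop := ∀ p ∈ m, x ∉ p

lemma maxMatching_iff {α : Type} (m : Finset (Sym2 α)) :
    IsMaximalMatching m ↔ IsPairMatching m ∧ ∀ x y, Unm m x → Unm m y → x = y := by
  constructor
  · rintro ⟨h1, h2⟩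
    refine ⟨h1, fun x y hx hy => ?_⟩
    by_contra hne
    have : IsPairMatching (insert s(x, y) m) := by
      constructor
      · intro p hp
        rcases Finset.mem_insert.1 hp with rfl | hp
        · simpa using hne
        · exact h1.1 p hp
      · intro p hp q hq hpq k hk hk'
        replace hp := Finset.mem_insert.1 hp
        replace hq := Finset.mem_insert.1 hq
        rcases hp with rfl | hp <;> rcases hq with rfl | hq
        · exact hpq rfl
        · rcases Sym2.mem_iff.1 hk with rfl | rfl
          · exact hx q hq hk'
          · exact hy q hq hk'
        · rcases Sym2.mem_iff.1 hk' with rfl | rfl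
          · exact hx p hp hk
          · exact hy p hp hk
        · exact h1.2 p hp q hq hpq k hk hk'
    have h3 := h2 _ this (Finset.subset_insert _ _)
    have h4 : s(x, y) ∈ m := by rw [← h3]; exact Finset.mem_insert_self _ _
    exact hx _ h4 (Sym2.mem_mk_left x y)
  · rintro ⟨h1, h2⟩
    refine ⟨h1, fun m' hm' hsub => ?_⟩
    refine Finset.Subset.antisymm ?_ hsub
    intro q hq
    by_contra hqm
    have hu : ∀ k ∈ q, Unm m k := fun k hk p hp hkp =>
      hm'.2 p (hsub hp) q hq (fun h => hqm (h ▸ hp)) k hkp hk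
    induction q with
    | _ x y =>
      exact hm'.1 _ hq (by simpa using h2 x y (hu x (by simp)) (hu y (by simp)))

lemma card_unm {α : Type} [Fintype α] (m : Finset (Sym2 α)) (h : IsPairMatching m) :
    Fintype.card α = 2 * m.card + (Finset.univ.filter fun x => Unm m x).card := by
  have h1 : (m.biUnion fun p => p.toFinset).card = 2 * m.card := by
    rw [Finset.card_biUnion]
    · rw [Finset.sum_congr rfl (fun p hp => Sym2.card_toFinset_of_not_isDiag p (h.1 p hp))]
      simp [mul_comm]
    · intro p hp q hq hpq
      show Disjoint p.toFinset q.toFinset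
      rw [Finset.disjoint_left]
      intro k hk hk'
      exact h.2 p hp q hq hpq k (by simpa using hk) (by simpa using hk')
  have h2 : (Finset.univ.filter fun x => Unm m x) = (m.biUnion fun p => p.toFinset)ᶜ := by
    ext x
    rw [Finset.mem_filter, Finset.mem_compl, Finset.mem_biUnion]
    simp [Unm]
  rw [h2, ← h1, Finset.card_add_card_compl]

lemma even_cov {α : Type} [Fintype α] (m : Finset (Sym2 α)) (h : IsMaximalMatching m)
    (he : Even (Fintype.card α)) (x : α) : ∃ p ∈ m, x ∈ p := by
  rw [maxMatching_iff] at h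
  by_contra hx
  have hx : Unm m x := by simpa [Unm] using hx
  have h1 : (Finset.univ.filter fun x => Unm m x) = {x} := by
    ext y
    simp only [Finset.mem_filter, Finset.mem_univ, true_and, Finset.mem_singleton]
    exact ⟨fun hy => h.2 _ _ hy hx, fun e => e ▸ hx⟩
  have := card_unm m h.1
  rw [h1, Finset.card_singleton] at this
  rw [this] at he
  revert he
  simp [parity_simps]

lemma odd_unm {α : Type} [Fintype α] (m : Finset (Sym2 α)) (h : IsMaximalMatching m)
    (he : ¬ Even (Fintype.card α)) : ∃ x, Unm m x := by
  by_contra hx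
  push Not at hx
  have h1 : (Finset.univ.filter fun x => Unm m x) = ∅ := by
    ext y
    simp [hx]
  have := card_unm m h.1
  rw [h1] at this
  apply he
  rw [this]
  simp

/-- Restriction of a matching along a map. -/
noncomputable def restr {α β : Type} [Fintype α] (g : α → β) (m' : Finset (Sym2 β)) :
    Finset (Sym2 α) := Finset.univ.filter fun p => Sym2.map g p ∈ m'

lemma mem_restr {α β : Type} [Fintype α] (g : α → β) (m' : Finset (Sym2 β)) (p : Sym2 α) :
    p ∈ restr g m' ↔ Sym2.map g p ∈ m' := by simp [restr]

lemma map_mem_iff {α β : Type} {g : α → β} (hg : Function.Injective g) (p : Sym2 α) (a : α) :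
    g a ∈ Sym2.map g p ↔ a ∈ p := by
  rw [Sym2.mem_map]
  exact ⟨fun ⟨b, hb, e⟩ => hg e ▸ hb, fun h => ⟨a, h, rfl⟩⟩

lemma map_diag_iff {α β : Type} {g : α → β} (hg : Function.Injective g) (p : Sym2 α) :
    (Sym2.map g p).IsDiag ↔ p.IsDiag := by
  induction p with
  | _ x y => simp [hg.eq_iff]

lemma restr_matching {α β : Type} [Fintype α] {g : α → β} (hg : Function.Injective g)
    {m' : Finset (Sym2 β)} (h : IsPairMatching m') : IsPairMatching (restr g m') := by
  constructor
  · intro p hp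
    rw [mem_restr] at hp
    have := h.1 _ hp
    rwa [map_diag_iff hg] at this
  · intro p hp q hq hpq k hk hk'
    rw [mem_restr] at hp hq
    exact h.2 _ hp _ hq (fun e => hpq (Sym2.map.injective hg e)) (g k)
      ((map_mem_iff hg p k).2 hk) ((map_mem_iff hg q k).2 hk')

lemma image_matching {α β : Type} {g : α → β} (hg : Function.Injective g)
    {m : Finset (Sym2 α)} (h : IsPairMatching m) : IsPairMatching (m.image (Sym2.map g)) := by
  constructor
  · intro p hp
    replace hp := Finset.mem_image.1 hp
    obtain ⟨p, hp, rfl⟩ := hp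
    rw [map_diag_iff hg]
    exact h.1 p hp
  · intro p hp q hq hpq k hk hk'
    replace hp := Finset.mem_image.1 hp
    obtain ⟨p, hp, rfl⟩ := hp
    replace hq := Finset.mem_image.1 hq
    obtain ⟨q, hq, rfl⟩ := hq
    obtain ⟨a, ha, rfl⟩ := Sym2.mem_map.1 hk
    rw [map_mem_iff hg] at hk'
    exact h.2 p hp q hq (fun e => hpq (by rw [e])) a ha hk'

lemma image_unm {α β : Type} {g : α → β} (hg : Function.Injective g)
    {m : Finset (Sym2 α)} (a : α) : Unm (m.image (Sym2.map g)) (g a) ↔ Unm m a := by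
  simp [Unm, map_mem_iff hg]

lemma image_unm' {α β : Type} {g : α → β} {b : β} (hb : ∀ a, g a ≠ b)
    (m : Finset (Sym2 α)) : Unm (m.image (Sym2.map g)) b := by
  intro p hp hbp
  obtain ⟨p, hp, rfl⟩ := Finset.mem_image.1 hp
  obtain ⟨a, ha, e⟩ := Sym2.mem_map.1 hbp
  exact hb a e

lemma lift_sym2 {α β : Type} {g : α → β} {b : β} (hr : ∀ c, c ≠ b → ∃ a, g a = c)
    (q : Sym2 β) (hq : b ∉ q) : ∃ p, Sym2.map g p = q := by
  induction q with
  | _ x y =>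
    rw [Sym2.mem_iff] at hq
    push Not at hq
    obtain ⟨a, rfl⟩ := hr x hq.1.symm
    obtain ⟨c, rfl⟩ := hr y hq.2.symm
    exact ⟨s(a, c), by simp⟩

lemma image_restr {α β : Type} [Fintype α] {g : α → β} {b : β} (hr : ∀ c, c ≠ b → ∃ a, g a = c)
    {m' : Finset (Sym2 β)} (hb : Unm m' b) : (restr g m').image (Sym2.map g) = m' := by
  ext q
  rw [Finset.mem_image]
  constructor
  · rintro ⟨p, hp, rfl⟩
    exact (mem_restr _ _ _).1 hp
  · intro hq
    obtain ⟨p, rfl⟩ := lift_sym2 hr q (hb q hq)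
    exact ⟨p, (mem_restr _ _ _).2 hq, rfl⟩

def eg {V : Type} [Fintype V] (E : Multiset (Sym2 V)) : Multigraph := { V := V, edges := E }

lemma lip_eg {V : Type} [Fintype V] {f : Multigraph → ℝ} {κ : ℝ}
    (hlip : GraphParam.Lipschitz f κ) (E : Multiset (Sym2 V)) (i j : V) :
    |f (eg (s(i, j) ::ₘ E)) - f (eg E)| ≤ κ := hlip (eg E) i j

def me {V α : Type} (π : α → V) (m : Finset (Sym2 α)) : Multiset (Sym2 V) :=
  m.val.map (Sym2.map π)

lemma me_insert {V α : Type} (π : α → V) (m : Finset (Sym2 α)) (a b : α)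
    (h : s(a, b) ∉ m) : me π (insert s(a, b) m) = s(π a, π b) ::ₘ me π m := by
  simp only [me]
  rw [Finset.insert_val_of_notMem h, Multiset.map_cons, Sym2.map_mk]

lemma me_image {V α β : Type} (π : β → V) (g : α → β) (hg : Function.Injective g)
    (m : Finset (Sym2 α)) : me π (m.image (Sym2.map g)) = me (π ∘ g) m := by
  simp only [me]
  rw [Finset.image_val_of_injOn (Sym2.map.injective hg).injOn, Multiset.map_map, Sym2.map_comp]

section step
variable {V α β : Type} [Fintype V] [Fintype α] [Fintype β]

lemma step_odd (f : Multigraph → ℝ) (κ : ℝ) (hκ : 0 ≤ κ) (hlip : GraphParam.Lipschitz f κ)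
    (π : α → V) (π' : β → V) (ι : α → β) (h : β) (hι : Function.Injective ι)
    (hh : ∀ a, ι a ≠ h) (hr : ∀ c, c ≠ h → ∃ a, ι a = c) (hπ : π' ∘ ι = π)
    (A : Finset (Finset (Sym2 α))) (B : Finset (Finset (Sym2 β)))
    (hA : ∀ m, m ∈ A ↔ IsMaximalMatching m) (hB : ∀ m, m ∈ B ↔ IsMaximalMatching m)
    (ho : ¬ Even (Fintype.card α)) (he : Even (Fintype.card β)) :
    |(∑ m ∈ B, f (eg (me π' m))) / (B.card : ℝ) - (∑ m ∈ A, f (eg (me π m))) / (A.card : ℝ)| ≤ κ := by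
  have hex : ∀ m : Finset (Sym2 α), ∃ x : α, m ∈ A → Unm m x := by
    intro m
    by_cases hm : m ∈ A
    · obtain ⟨x, hx⟩ := odd_unm m ((hA m).1 hm) ho
      exact ⟨x, fun _ => hx⟩
    · have : 0 < Fintype.card α := Nat.pos_of_ne_zero (fun h0 => ho (by simp [h0]))
      obtain ⟨x⟩ := Fintype.card_pos_iff.1 this
      exact ⟨x, fun h => absurd h hm⟩
  choose u hu using hex
  have hnot : ∀ (m : Finset (Sym2 α)) (b : β), s(h, b) ∉ m.image (Sym2.map ι) := fun m b hm =>
    image_unm' hh m _ hm (Sym2.mem_mk_left _ _)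
  have hres : ∀ (m : Finset (Sym2 α)) (b : β) (p : Sym2 α),
      Sym2.map ι p ∈ insert s(h, b) (m.image (Sym2.map ι)) ↔ p ∈ m := by
    intro m b p
    rw [Finset.mem_insert]
    constructor
    · rintro (e | e)
      · have : h ∈ Sym2.map ι p := by rw [e]; exact Sym2.mem_mk_left _ _
        obtain ⟨a, _, e⟩ := Sym2.mem_map.1 this
        exact absurd e (hh a)
      · obtain ⟨q, hq, e⟩ := Finset.mem_image.1 e
        exact Sym2.map.injective hι e ▸ hq
    · intro hp
      exact Or.inr (Finset.mem_image_of_mem _ hp)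
  refine avg_bound A B ({()} : Finset Unit) (by simp)
    (fun m _ => insert s(h, ι (u m)) (m.image (Sym2.map ι))) _ _ κ hκ ?_ ?_ ?_ ?_
  · intro m hm _ _
    have hum := hu m hm
    rw [hA, maxMatching_iff] at hm
    rw [hB, maxMatching_iff]
    have him := image_matching hι hm.1
    have hx := image_unm' hh m
    have hy := (image_unm hι (m := m) (u m)).2 hum
    constructor
    · constructor
      · intro p hp
        rcases Finset.mem_insert.1 hp with rfl | hp
        · simpa using (hh _).symm
        · exact him.1 p hp
      · intro p hp q hq hpq k hk hk'
        replace hp := Finset.mem_insert.1 hp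
        replace hq := Finset.mem_insert.1 hq
        rcases hp with rfl | hp <;> rcases hq with rfl | hq
        · exact hpq rfl
        · rcases Sym2.mem_iff.1 hk with rfl | rfl
          · exact hx q hq hk'
          · exact hy q hq hk'
        · rcases Sym2.mem_iff.1 hk' with rfl | rfl
          · exact hx p hp hk
          · exact hy p hp hk
        · exact him.2 p hp q hq hpq k hk hk'
    · have : ∀ x, ¬ Unm (insert s(h, ι (u m)) (m.image (Sym2.map ι))) x := by
        intro x hx'
        by_cases hxh : x = h
        · exact hx' _ (Finset.mem_insert_self _ _) (by simp [hxh])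
        · obtain ⟨a, rfl⟩ := hr x hxh
          have h1 : Unm m a := (image_unm hι a).1
            (fun p hp => hx' p (Finset.mem_insert_of_mem hp))
          have := hm.2 _ _ h1 hum
          exact hx' _ (Finset.mem_insert_self _ _) (by simp [this])
      intro x y hx
      exact absurd hx (this x)
  · intro m _ _ _ m2 _ _ _ e
    refine ⟨?_, rfl⟩
    ext p
    rw [← hres m (ι (u m)) p, ← hres m2 (ι (u m2)) p]
    exact iff_of_eq (congrArg (fun s => Sym2.map ι p ∈ s) e)
  · intro m' hm'
    have hm := (hB m').1 hm'
    obtain ⟨p, hp, hhp⟩ := even_cov m' hm he h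
    obtain ⟨b, rfl⟩ := Sym2.mem_iff_exists.1 hhp
    have hbh : b ≠ h := by
      intro e
      exact hm.1.1 _ hp (by simp [e])
    obtain ⟨a, rfl⟩ := hr b hbh
    have huniq : ∀ x, Unm (restr ι m') x → x = a := by
      intro x hx
      obtain ⟨q, hq, hxq⟩ := even_cov m' hm he (ι x)
      by_cases hqe : q = s(h, ι a)
      · rw [hqe, Sym2.mem_iff] at hxq
        rcases hxq with e | e
        · exact absurd e (hh x)
        · exact hι e
      · have : h ∉ q := fun hhq => hm.1.2 _ hq _ hp hqe h hhq hhp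
        obtain ⟨p, rfl⟩ := lift_sym2 hr q this
        exact absurd ((map_mem_iff hι _ _).1 hxq) (hx p ((mem_restr _ _ _).2 hq))
    have hmA : restr ι m' ∈ A := by
      rw [hA, maxMatching_iff]
      exact ⟨restr_matching hι hm.1, fun x y hx hy => (huniq x hx).trans (huniq y hy).symm⟩
    refine ⟨_, hmA, (), by simp, ?_⟩
    rw [huniq _ (hu _ hmA)]
    ext q
    rw [Finset.mem_insert]
    constructor
    · rintro (rfl | hq)
      · exact hp
      · replace hq := Finset.mem_image.1 hq
        obtain ⟨q, hq, rfl⟩ := hq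
        exact (mem_restr _ _ _).1 hq
    · intro hq
      by_cases hqe : q = s(h, ι a)
      · exact Or.inl hqe
      · right
        have : h ∉ q := fun hhq => hm.1.2 _ hq _ hp hqe h hhq hhp
        obtain ⟨p, rfl⟩ := lift_sym2 hr q this
        exact Finset.mem_image_of_mem _ ((mem_restr _ _ _).2 hq)
  · intro m hm _ _
    rw [me_insert _ _ _ _ (hnot m _), me_image _ _ hι, hπ]
    exact lip_eg hlip (me π m) _ _

lemma step_even (f : Multigraph → ℝ) (κ : ℝ) (hκ : 0 ≤ κ) (hlip : GraphParam.Lipschitz f κ)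
    (π : α → V) (π' : β → V) (ι : α → β) (h : β) (hι : Function.Injective ι)
    (hh : ∀ a, ι a ≠ h) (hr : ∀ c, c ≠ h → ∃ a, ι a = c) (hπ : π' ∘ ι = π)
    (A : Finset (Finset (Sym2 α))) (B : Finset (Finset (Sym2 β)))
    (hA : ∀ m, m ∈ A ↔ IsMaximalMatching m) (hB : ∀ m, m ∈ B ↔ IsMaximalMatching m)
    (he : Even (Fintype.card α)) (ho : ¬ Even (Fintype.card β)) :
    |(∑ m ∈ B, f (eg (me π' m))) / (B.card : ℝ) - (∑ m ∈ A, f (eg (me π m))) / (A.card : ℝ)| ≤ 2 * κ := by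
  let g : β → α → β := fun y => Equiv.swap h y ∘ ι
  have hg : ∀ y, Function.Injective (g y) := fun y => (Equiv.swap h y).injective.comp hι
  have hgy : ∀ y a, g y a ≠ y := by
    intro y a e
    have : Equiv.swap h y (ι a) = Equiv.swap h y h := by rw [Equiv.swap_apply_left]; exact e
    exact hh a ((Equiv.swap h y).injective this)
  have hgr : ∀ y c, c ≠ y → ∃ a, g y a = c := by
    intro y c hc
    have : Equiv.swap h y c ≠ h := by
      intro e
      apply hc
      have := congrArg (Equiv.swap h y) e
      simpa using this
    obtain ⟨a, ha⟩ := hr _ this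
    exact ⟨a, by simp [g, ha]⟩
  have hun : ∀ m ∈ A, ∀ y x, Unm (m.image (Sym2.map (g y))) x → x = y := by
    intro m hm y x hx
    by_contra hne
    obtain ⟨a, rfl⟩ := hgr y x hne
    obtain ⟨p, hp, hap⟩ := even_cov m ((hA m).1 hm) he a
    exact (image_unm (hg y) a).1 hx p hp hap
  refine avg_bound A B (Finset.univ : Finset β) ⟨h, Finset.mem_univ _⟩
    (fun m y => m.image (Sym2.map (g y))) _ _ _ (by linarith) ?_ ?_ ?_ ?_
  · intro m hm y _
    rw [hB, maxMatching_iff]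
    exact ⟨image_matching (hg y) ((hA m).1 hm).1,
      fun x z hx hz => (hun m hm y x hx).trans (hun m hm y z hz).symm⟩
  · intro m hm y _ m2 hm2 y2 _ e
    have e1 : y = y2 := by
      have h1 := image_unm' (hgy y) m
      have e : m.image (Sym2.map (g y)) = m2.image (Sym2.map (g y2)) := e
      rw [e] at h1
      exact hun m2 hm2 y2 y h1
    subst e1
    exact ⟨Finset.image_injective (Sym2.map.injective (hg y)) e, rfl⟩
  · intro m' hm'
    have hm := (hB m').1 hm'
    obtain ⟨y, hy⟩ := odd_unm m' hm ho
    have him := image_restr (hgr y) hy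
    refine ⟨restr (g y) m', ?_, y, Finset.mem_univ _, him⟩
    rw [hA, maxMatching_iff]
    refine ⟨restr_matching (hg y) hm.1, fun x z hx _ => ?_⟩
    have h1 : Unm m' (g y x) := by
      rw [← him]
      exact (image_unm (hg y) x).2 hx
    exact absurd (((maxMatching_iff m').1 hm).2 _ _ h1 hy) (hgy y x)
  · intro m hm y _
    rw [me_image _ _ (hg y)]
    by_cases hy : y = h
    · have : π' ∘ g y = π := by
        rw [← hπ]
        subst hy
        funext a
        simp [g]
      rw [this]
      simp [hκ]
    · obtain ⟨a, rfl⟩ := hr y hy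
      obtain ⟨p, hp, hap⟩ := even_cov m ((hA m).1 hm) he a
      obtain ⟨c, rfl⟩ := Sym2.mem_iff_exists.1 hap
      have hga : ∀ x, x ≠ a → π' (g (ι a) x) = π x := by
        intro x hx
        simp only [g, Function.comp]
        rw [Equiv.swap_apply_of_ne_of_ne (hh x) (fun e => hx (hι e)), ← hπ]
        rfl
      have hmi : m = insert s(a, c) (m.erase s(a, c)) := (Finset.insert_erase hp).symm
      have hmm := ((hA m).1 hm).1
      set m0 := m.erase s(a, c) with hm0
      have hni : s(a, c) ∉ m0 := Finset.notMem_erase _ _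
      have hbase : me (π' ∘ g (ι a)) m0 = me π m0 := by
        simp only [me]
        refine Multiset.map_congr rfl ?_
        intro q hq
        have hq : q ∈ m.erase s(a, c) := hq
        rw [Finset.mem_erase] at hq
        refine Sym2.map_congr ?_
        intro x hx
        refine hga x ?_
        rintro rfl
        exact hmm.2 _ hq.2 _ hp hq.1 x hx hap
      have e1 := lip_eg hlip (me π m0) ((π' ∘ g (ι a)) a) ((π' ∘ g (ι a)) c)
      have e2 := lip_eg hlip (me π m0) (π a) (π c)
      rw [hmi, me_insert _ _ _ _ hni, me_insert _ _ _ _ hni, hbase]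
      rw [abs_le] at e1 e2 ⊢
      constructor <;> linarith [e1.1, e1.2, e2.1, e2.2]

end step

lemma one_step {n : ℕ} (f : Multigraph → ℝ) (κ : ℝ) (hκ : 0 ≤ κ)
    (hlip : GraphParam.Lipschitz f κ) (d : Fin n → ℕ) (i : Fin n) (d' : Fin n → ℕ)
    (hi : d' i = d i + 1) (hne : ∀ j, j ≠ i → d' j = d j) :
    |configExpect (Fin n) d' f - configExpect (Fin n) d f| ≤ 2 * κ := by
  have hle : ∀ j, d j ≤ d' j := by
    intro j
    by_cases h : j = i
    · subst h; omega
    · rw [hne j h]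
  let ι : HalfEdge (Fin n) d → HalfEdge (Fin n) d' := fun x => ⟨x.1, Fin.castLE (hle x.1) x.2⟩
  let h : HalfEdge (Fin n) d' := ⟨i, ⟨d i, by omega⟩⟩
  have hι : Function.Injective ι := by
    rintro ⟨j, s⟩ ⟨k, t⟩ e
    simp only [ι, Sigma.mk.injEq] at e
    obtain ⟨rfl, e⟩ := e
    simpa using e
  have hh : ∀ a, ι a ≠ h := by
    rintro ⟨j, s⟩ e
    simp only [ι, h, Sigma.mk.injEq] at e
    obtain ⟨rfl, e⟩ := e
    have := congrArg Fin.val (eq_of_heq e)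
    have h2 := s.2
    simp at this
    omega
  have hr : ∀ c, c ≠ h → ∃ a, ι a = c := by
    rintro ⟨j, s⟩ hc
    have hs : s.1 < d j := by
      by_cases hj : j = i
      · subst hj
        have h1 := s.2
        have h2 : s.1 ≠ d j := by
          intro e
          apply hc
          simp only [h, Sigma.mk.injEq, true_and]
          exact heq_of_eq (Fin.ext e)
        omega
      · have h1 := s.2
        rw [← hne j hj]; exact h1
    exact ⟨⟨j, ⟨s.1, hs⟩⟩, rfl⟩
  have hcard : Fintype.card (HalfEdge (Fin n) d') = Fintype.card (HalfEdge (Fin n) d) + 1 := by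
    rw [Fintype.card_sigma, Fintype.card_sigma]
    simp only [Fintype.card_fin]
    rw [← Finset.add_sum_erase _ d' (Finset.mem_univ i), ← Finset.add_sum_erase _ d (Finset.mem_univ i),
      hi, Finset.sum_congr rfl (fun j hj => hne j (Finset.ne_of_mem_erase hj))]
    ring
  have hA : ∀ m, m ∈ maximalMatchings (Fin n) d ↔ IsMaximalMatching m := by
    intro m; simp [maximalMatchings]
  have hB : ∀ m, m ∈ maximalMatchings (Fin n) d' ↔ IsMaximalMatching m := by
    intro m; simp [maximalMatchings]
  by_cases he : Even (Fintype.card (HalfEdge (Fin n) d))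
  · exact step_even f κ hκ hlip Sigma.fst Sigma.fst ι h hι hh hr rfl _ _ hA hB he
      (by rw [hcard, Nat.even_add_one]; simpa using he)
  · have := step_odd f κ hκ hlip Sigma.fst Sigma.fst ι h hι hh hr rfl _ _ hA hB he
      (by rw [hcard, Nat.even_add_one]; exact he)
    have h2 : |configExpect (Fin n) d' f - configExpect (Fin n) d f| ≤ κ := this
    linarith

lemma multi_step {n : ℕ} (f : Multigraph → ℝ) (κ : ℝ) (hκ : 0 ≤ κ)
    (hlip : GraphParam.Lipschitz f κ) (d : Fin n → ℕ) (k : ℕ) : ∀ (e : Fin n → ℕ),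
    ∑ i, e i = k →
    |configExpect (Fin n) (fun i => d i + e i) f - configExpect (Fin n) d f| ≤ 2 * κ * k := by
  induction k with
  | zero =>
    intro e he
    have : (fun i => d i + e i) = d := by
      funext i
      have := Finset.sum_eq_zero_iff.1 he i (Finset.mem_univ i)
      omega
    rw [this]; simp
  | succ k ih =>
    intro e he
    have : ∃ i, 0 < e i := by
      by_contra hno
      push Not at hno
      have : ∑ i, e i = 0 := Finset.sum_eq_zero (fun i _ => Nat.le_zero.1 (hno i))
      omega
    obtain ⟨i, hi⟩ := this
    let e' : Fin n → ℕ := Function.update e i (e i - 1)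
    have he'i : e' i = e i - 1 := by simp [e']
    have he'j : ∀ j, j ≠ i → e' j = e j := fun j hj => by simp [e', hj]
    have hs : ∑ i, e' i = k := by
      rw [← Finset.add_sum_erase _ e (Finset.mem_univ i)] at he
      have hi' := hi
      rw [← Finset.add_sum_erase _ e' (Finset.mem_univ i),
        Finset.sum_congr rfl (fun j hj => he'j j (Finset.ne_of_mem_erase hj)), he'i]
      generalize (Finset.univ.erase i).sum e = S at he ⊢
      omega
    have h1 := ih e' hs
    have h2 := one_step f κ hκ hlip (fun i => d i + e' i) i (fun i => d i + e i)
      (by simp only [he'i]; omega) (fun j hj => by simp only [he'j j hj])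
    push_cast
    rw [abs_le] at *
    constructor <;> linarith [h1.1, h1.2, h2.1, h2.2]

theorem statement12 (f : Multigraph → ℝ) (κ : ℝ)
    (hinv : GraphParam.Invariant f) (hadd : GraphParam.Additive f)
    (hlip : GraphParam.Lipschitz f κ)
    (n : ℕ) (hn : 1 ≤ n) (d d' : Fin n → ℕ) :
    |configExpect (Fin n) d f - configExpect (Fin n) d' f| ≤
      2 * κ * ∑ i : Fin n, |(d i : ℝ) - (d' i : ℝ)| := by
  have hκ : 0 ≤ κ := (abs_nonneg _).trans (hlip { V := Unit, edges := 0 } () ())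
  have h1 := multi_step f κ hκ hlip (fun i => min (d i) (d' i)) _ (fun i => d i - d' i) rfl
  have h2 := multi_step f κ hκ hlip (fun i => min (d i) (d' i)) _ (fun i => d' i - d i) rfl
  have e1 : (fun i => min (d i) (d' i) + (d i - d' i)) = d := by funext i; omega
  have e2 : (fun i => min (d i) (d' i) + (d' i - d i)) = d' := by funext i; omega
  have e3 : ∑ i : Fin n, |(d i : ℝ) - (d' i : ℝ)|
      = ((∑ i, (d i - d' i) : ℕ) : ℝ) + ((∑ i, (d' i - d i) : ℕ) : ℝ) := by
    push_cast
    rw [← Finset.sum_add_distrib]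
    refine Finset.sum_congr rfl fun i _ => ?_
    rcases le_total (d i) (d' i) with hl | hl
    · have hl' : (d i : ℝ) ≤ d' i := by exact_mod_cast hl
      rw [Nat.sub_eq_zero_of_le hl, Nat.cast_sub hl, abs_of_nonpos (by linarith)]
      simp
    · have hl' : (d' i : ℝ) ≤ d i := by exact_mod_cast hl
      rw [Nat.sub_eq_zero_of_le hl, Nat.cast_sub hl, abs_of_nonneg (by linarith)]
      simp
  rw [e1] at h1
  rw [e2] at h2
  rw [e3, mul_add]
  rw [abs_le] at *
  constructor <;> linarith [h1.1, h1.2, h2.1, h2.2]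
end

section
/- Let 𝔣 be an additive, κ-Lipschitz, concave graph parameter, let μ be a probability measure on ℕ with finite mean, let Ψ(μ) := lim_{n→∞} E[𝔣(𝔾^iid_{μ,n})]/n, and let {d_n}_{n≥1} be a sequence of degree functions approaching μ. Then E[𝔣(𝔾_{d_n})]/n → Ψ(μ) as n → ∞. -/
open Finset Filter Topology MeasureTheory
open scoped Classical BigOperators ENNReal

namespace CM

def smap {α β : Type} (j : α ↪ β) : Sym2 α ↪ Sym2 β := ⟨Sym2.map j, Sym2.map.injective j.injective⟩

@[simp] lemma smap_mk {α β : Type} (j : α ↪ β) (a b : α) : smap j s(a, b) = s(j a, j b) := rfl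

lemma pm_map {α β : Type} (j : α ↪ β) {m : Finset (Sym2 α)} (h : IsPairMatching m) :
    IsPairMatching (m.map (smap j)) := by
  refine ⟨?_, ?_⟩
  · intro p hp
    obtain ⟨q, hq, rfl⟩ := Finset.mem_map.1 hp
    have := h.1 q hq
    induction q with | _ a b =>
    simpa using this
  · intro p hp q hq hpq x hx hx'
    obtain ⟨p, hp', rfl⟩ := Finset.mem_map.1 hp
    obtain ⟨q, hq', rfl⟩ := Finset.mem_map.1 hq
    obtain ⟨a, ha, rfl⟩ := Sym2.mem_map.1 hx
    obtain ⟨b, hb, hab⟩ := Sym2.mem_map.1 hx'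
    have := j.injective hab
    subst this
    exact h.2 p hp' q hq' (fun h => hpq (by rw [h])) b ha hb

lemma pm_of_map {α β : Type} (j : α ↪ β) {m : Finset (Sym2 α)} (h : IsPairMatching (m.map (smap j))) :
    IsPairMatching m := by
  refine ⟨?_, ?_⟩
  · intro p hp
    have := h.1 _ (Finset.mem_map_of_mem (smap j) hp)
    induction p with | _ a b =>
    simpa using this
  · intro p hp q hq hpq x hx hx'
    refine h.2 _ (Finset.mem_map_of_mem (smap j) hp) _ (Finset.mem_map_of_mem (smap j) hq)
      (fun h => hpq ((smap j).injective h)) (j x) ?_ ?_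
    · exact Sym2.mem_map.2 ⟨x, hx, rfl⟩
    · exact Sym2.mem_map.2 ⟨x, hx', rfl⟩

lemma map_symm_map {α β : Type} (e : α ≃ β) (m : Finset (Sym2 α)) :
    (m.map (smap e.toEmbedding)).map (smap e.symm.toEmbedding) = m := by
  ext p
  induction p with | _ a b =>
  simp only [Finset.mem_map, exists_exists_and_eq_and]
  constructor
  · rintro ⟨q, hq, h⟩
    induction q with | _ c d =>
    simp at h
    rcases h with ⟨rfl, rfl⟩ | ⟨rfl, rfl⟩
    · exact hq
    · rwa [Sym2.eq_swap]
  · intro h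
    exact ⟨_, h, by simp⟩

lemma mm_map {α β : Type} (e : α ≃ β) {m : Finset (Sym2 α)} (h : IsMaximalMatching m) :
    IsMaximalMatching (m.map (smap e.toEmbedding)) := by
  refine ⟨pm_map _ h.1, fun m' hm' hsub => ?_⟩
  have h1 := h.2 (m'.map (smap e.symm.toEmbedding)) (pm_map _ hm') (by
    have := Finset.map_subset_map (f := smap e.symm.toEmbedding).2 hsub
    rwa [map_symm_map] at this)
  rw [← h1]
  exact (map_symm_map e.symm m').symm

lemma pm_insert {α : Type} {m : Finset (Sym2 α)} (h : IsPairMatching m) {a b : α} (hab : a ≠ b)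
    (ha : ∀ p ∈ m, a ∉ p) (hb : ∀ p ∈ m, b ∉ p) : IsPairMatching (insert s(a, b) m) := by
  refine ⟨?_, ?_⟩
  · intro p hp
    rcases Finset.mem_insert.1 hp with rfl | hp
    · simpa using hab
    · exact h.1 p hp
  · intro p hp q hq hpq x hx hx'
    rcases Finset.mem_insert.1 hp with rfl | hp' <;> rcases Finset.mem_insert.1 hq with rfl | hq'
    · exact hpq rfl
    · rcases Sym2.mem_iff.1 hx with rfl | rfl
      · exact ha _ hq' hx'
      · exact hb _ hq' hx'
    · rcases Sym2.mem_iff.1 hx' with rfl | rfl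
      · exact ha _ hp' hx
      · exact hb _ hp' hx
    · exact h.2 p hp' q hq' hpq x hx hx'

lemma pm_unique {α : Type} {m : Finset (Sym2 α)} (h : IsPairMatching m) {a b c : α}
    (h1 : s(a, b) ∈ m) (h2 : s(a, c) ∈ m) : b = c := by
  by_contra hbc
  refine h.2 _ h1 _ h2 ?_ a (by simp) (by simp)
  intro h
  simp at h
  grind

lemma exists_involution {α : Type} {m : Finset (Sym2 α)} (h : IsMaximalMatching m) :
    ∃ σ : Equiv.Perm α, σ ^ 2 = 1 ∧ (∀ a b, s(a, b) ∈ m ↔ a ≠ b ∧ σ a = b) ∧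
      ∀ a b, σ a = a → σ b = b → a = b := by
  let g : α → α := fun a => if h : ∃ b, s(a, b) ∈ m then h.choose else a
  have g1 : ∀ a b, s(a, b) ∈ m → g a = b := by
    intro a b hab
    have hex : ∃ b, s(a, b) ∈ m := ⟨b, hab⟩
    have : g a = hex.choose := dif_pos hex
    rw [this]
    exact pm_unique h.1 hex.choose_spec hab
  have g2 : ∀ a, (¬ ∃ b, s(a, b) ∈ m) → g a = a := fun a ha => dif_neg ha
  have gi : Function.Involutive g := by
    intro a
    by_cases ha : ∃ b, s(a, b) ∈ m
    · obtain ⟨b, hb⟩ := ha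
      rw [g1 a b hb]
      exact g1 b a (by rwa [Sym2.eq_swap])
    · rw [g2 a ha, g2 a ha]
  have g3 : ∀ a b, s(a, b) ∈ m ↔ a ≠ b ∧ g a = b := by
    intro a b
    constructor
    · intro hab
      exact ⟨by simpa using h.1.1 _ hab, g1 a b hab⟩
    · rintro ⟨hne, hab⟩
      by_cases ha : ∃ b, s(a, b) ∈ m
      · obtain ⟨c, hc⟩ := ha
        rw [g1 a c hc] at hab
        rwa [← hab]
      · rw [g2 a ha] at hab
        exact absurd hab hne
  have g4 : ∀ a, g a = a → ∀ p ∈ m, a ∉ p := by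
    intro a ha p hp hap
    obtain ⟨b, rfl⟩ := Sym2.mem_iff_exists.1 hap
    have := (g3 a b).1 hp
    exact this.1 (ha.symm.trans this.2)
  refine ⟨gi.toPerm, ?_, g3, ?_⟩
  · ext a
    simp [sq, gi a]
  · intro a b ha hb
    by_contra hab
    have := h.2 _ (pm_insert h.1 hab (g4 a ha) (g4 b hb)) (Finset.subset_insert _ _)
    have h2 : s(a, b) ∈ m := by rw [← this]; exact Finset.mem_insert_self _ _
    exact g4 a ha _ h2 (by simp)

lemma transitive {α : Type} [Fintype α] {m m' : Finset (Sym2 α)} (h : IsMaximalMatching m)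
    (h' : IsMaximalMatching m') : ∃ τ : Equiv.Perm α, m.map (smap τ.toEmbedding) = m' := by
  obtain ⟨σ, hσ, hm, hf⟩ := exists_involution h
  obtain ⟨σ', hσ', hm', hf'⟩ := exists_involution h'
  have key : ∀ σ : Equiv.Perm α, σ ^ 2 = 1 → (∀ a b, σ a = a → σ b = b → a = b) →
      σ.cycleType = Multiset.replicate (Fintype.card α / 2) 2 := by
    intro σ hσ hf
    have h1 := Equiv.Perm.cycleType_of_pow_prime_eq_one (p := 2) hσ
    have h2 := σ.sum_cycleType
    rw [h1] at h2 ⊢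
    simp at h2
    have h3 : (σ.supportᶜ).card ≤ 1 := by
      rw [Finset.card_le_one]
      intro a ha b hb
      simp at ha hb
      exact hf a b ha hb
    rw [Finset.card_compl] at h3
    have h4 := Finset.card_le_univ σ.support
    congr 1
    omega
  have hc : IsConj σ σ' := by
    rw [Equiv.Perm.isConj_iff_cycleType_eq, key σ hσ hf, key σ' hσ' hf']
  obtain ⟨τ, hτ⟩ := isConj_iff.1 hc
  have hτ' : ∀ a, σ' (τ a) = τ (σ a) := by
    intro a; rw [← hτ]; simp
  refine ⟨τ, ?_⟩
  ext p
  induction p with | _ a b =>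
  rw [hm', Finset.mem_map]
  constructor
  · rintro ⟨q, hq, hqp⟩
    induction q with | _ c d =>
    have hcd := (hm c d).1 hq
    have hdc := (hm d c).1 (by rwa [Sym2.eq_swap])
    simp at hqp
    rcases hqp with ⟨rfl, rfl⟩ | ⟨rfl, rfl⟩
    · rw [hτ', hcd.2]; simpa using hcd.1
    · rw [hτ', hdc.2]; simpa using hdc.1
  · rintro ⟨hne, hab⟩
    refine ⟨s(τ.symm a, τ.symm b), ?_, by simp⟩
    rw [hm]
    refine ⟨by simpa using hne, ?_⟩
    rw [Equiv.eq_symm_apply, ← hτ', Equiv.apply_symm_apply, hab]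

lemma exists_maximal {α : Type} [Fintype α] {m : Finset (Sym2 α)} (h : IsPairMatching m) :
    ∃ m', m ⊆ m' ∧ IsMaximalMatching m' := by
  obtain ⟨m', h1, h2⟩ := Finite.exists_le_maximal (p := fun m : Finset (Sym2 α) => IsPairMatching m) h
  exact ⟨m', h1, h2.1, fun m'' h3 h4 => Finset.Subset.antisymm (h2.2 h3 h4) h4⟩

lemma exists_mm (α : Type) [Fintype α] : ∃ m : Finset (Sym2 α), IsMaximalMatching m := by
  obtain ⟨m', _, h⟩ := exists_maximal (α := α) (m := ∅) ⟨by simp, by simp⟩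
  exact ⟨m', h⟩

/-- all maximal matchings -/
noncomputable def MM (α : Type) [Fintype α] : Finset (Finset (Sym2 α)) :=
  Finset.univ.filter fun m => IsMaximalMatching m

lemma mem_MM {α : Type} [Fintype α] {m : Finset (Sym2 α)} : m ∈ MM α ↔ IsMaximalMatching m := by
  simp [MM]

noncomputable def avg (α : Type) [Fintype α] (g : Finset (Sym2 α) → ℝ) : ℝ :=
  (∑ m ∈ MM α, g m) / ((MM α).card : ℝ)

lemma avg_eq_perm {α : Type} [Fintype α] [DecidableEq α] (g : Finset (Sym2 α) → ℝ) {m₀ : Finset (Sym2 α)}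
    (h₀ : IsMaximalMatching m₀) :
    avg α g = (∑ τ : Equiv.Perm α, g (m₀.map (smap τ.toEmbedding))) /
      (Fintype.card (Equiv.Perm α) : ℝ) := by
  let Φ : Equiv.Perm α → Finset (Sym2 α) := fun τ => m₀.map (smap τ.toEmbedding)
  have hΦ : ∀ τ ∈ (Finset.univ : Finset (Equiv.Perm α)), Φ τ ∈ MM α :=
    fun τ _ => mem_MM.2 (mm_map τ h₀)
  have hmul : ∀ ρ τ : Equiv.Perm α, Φ (ρ * τ) = (Φ τ).map (smap ρ.toEmbedding) := by
    intro ρ τ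
    simp only [Φ, Finset.map_map]
    congr 1
    ext p
    induction p with | _ a b => rfl
  let c : ℕ := (Finset.univ.filter fun τ => Φ τ = m₀).card
  have hc : ∀ m ∈ MM α, (Finset.univ.filter fun τ => Φ τ = m).card = c := by
    intro m hm
    obtain ⟨ρ, hρ⟩ := transitive h₀ (mem_MM.1 hm)
    symm
    refine Finset.card_bij (fun τ _ => ρ * τ) ?_ ?_ ?_
    · intro τ hτ
      simp only [Finset.mem_filter, Finset.mem_univ, true_and] at hτ ⊢
      rw [hmul, hτ, hρ]
    · intro a _ b _ hab
      exact mul_left_cancel hab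
    · intro τ hτ
      simp only [Finset.mem_filter, Finset.mem_univ, true_and] at hτ
      refine ⟨ρ⁻¹ * τ, ?_, by simp⟩
      simp only [Finset.mem_filter, Finset.mem_univ, true_and]
      rw [hmul, hτ, ← hρ]
      exact map_symm_map ρ m₀
  have h1 : ∑ τ : Equiv.Perm α, g (Φ τ) = c * ∑ m ∈ MM α, g m := by
    rw [← Finset.sum_fiberwise_of_maps_to hΦ, Finset.mul_sum]
    refine Finset.sum_congr rfl fun m hm => ?_
    rw [Finset.sum_congr rfl (g := fun _ => g m), Finset.sum_const, hc m hm, nsmul_eq_mul]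
    intro τ hτ
    rw [(Finset.mem_filter.1 hτ).2]
  have h2 : (Fintype.card (Equiv.Perm α)) = c * (MM α).card := by
    rw [← Finset.card_univ, Finset.card_eq_sum_card_fiberwise hΦ, Finset.sum_congr rfl hc]
    simp [mul_comm]
  have h3 : (c : ℝ) ≠ 0 := by
    intro h
    have : c = 0 := by exact_mod_cast h
    rw [this, zero_mul] at h2
    exact Fintype.card_ne_zero h2
  change _ = (∑ τ : Equiv.Perm α, g (Φ τ)) / _
  rw [h1, h2, avg]
  push_cast
  rw [mul_div_mul_left _ _ h3]

lemma avg_equiv {α β : Type} [Fintype α] [Fintype β] (e : α ≃ β) (g : Finset (Sym2 β) → ℝ) :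
    avg β g = avg α (fun m => g (m.map (smap e.toEmbedding))) := by
  have h : ∀ g : Finset (Sym2 β) → ℝ, ∑ m ∈ MM β, g m =
      ∑ m ∈ MM α, g (m.map (smap e.toEmbedding)) := by
    intro g
    symm
    refine Finset.sum_bij (fun m _ => m.map (smap e.toEmbedding)) ?_ ?_ ?_ ?_
    · intro m hm; exact mem_MM.2 (mm_map e (mem_MM.1 hm))
    · intro a _ b _ hab; exact Finset.map_injective _ hab
    · intro b hb
      exact ⟨_, mem_MM.2 (mm_map e.symm (mem_MM.1 hb)), map_symm_map e.symm b⟩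
    · intros; rfl
  have h2 := h (fun _ => 1)
  simp at h2
  rw [avg, avg, h g, h2]

/-- average of `f` over random pairing with labels `l` -/
noncomputable def A (f : Multigraph → ℝ) {V W : Type} [Fintype V] [Fintype W] (l : W → V) : ℝ :=
  avg W (fun m => f { V := V, edges := m.val.map (Sym2.map l) })

lemma A_eq_perm (f : Multigraph → ℝ) {V W : Type} [Fintype V] [Fintype W] [DecidableEq W] (l : W → V)
    {m₀ : Finset (Sym2 W)} (h₀ : IsMaximalMatching m₀) :
    A f l = (∑ τ : Equiv.Perm W, f { V := V, edges := m₀.val.map (Sym2.map (l ∘ τ)) }) /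
      (Fintype.card (Equiv.Perm W) : ℝ) := by
  rw [A, avg_eq_perm _ h₀]
  congr 2
  ext τ
  congr 2
  simp only [Finset.map_val, Multiset.map_map]
  congr 1
  ext p
  induction p with | _ a b => rfl

lemma A_equiv (f : Multigraph → ℝ) {V W W' : Type} [Fintype V] [Fintype W] [Fintype W'] (l : W → V)
    (l' : W' → V) (e : W ≃ W') (he : ∀ w, l' (e w) = l w) : A f l' = A f l := by
  rw [A, avg_equiv e, A]
  congr 2
  ext m
  congr 2
  simp only [Finset.map_val, Multiset.map_map]
  congr 1
  ext p
  induction p with | _ a b => simp [smap, he]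

lemma A_fiber (f : Multigraph → ℝ) {V W W' : Type} [Fintype V] [Fintype W] [Fintype W'] (l : W → V)
    (l' : W' → V)
    (h : ∀ v, Fintype.card {w // l w = v} = Fintype.card {w // l' w = v}) : A f l' = A f l :=
  A_equiv f l l' (Equiv.ofFiberEquiv fun v => Fintype.equivOfCardEq (h v))
    (fun w => Equiv.ofFiberEquiv_map _ w)

lemma A_rename (f : Multigraph → ℝ) (hinv : GraphParam.Invariant f) {V V' W : Type} [Fintype V]
    [Fintype V'] [Fintype W] (l : W → V) (π : V ≃ V') : A f (π ∘ l) = A f l := by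
  rw [A, A]
  congr 2
  ext m
  symm
  refine hinv _ _ π ?_
  simp only [Multiset.map_map]
  congr 1
  ext p
  induction p with | _ a b => rfl

end CM

namespace CM

section lip
variable {f : Multigraph → ℝ} {κ : ℝ}

lemma kappa_nonneg (hlip : GraphParam.Lipschitz f κ) : 0 ≤ κ :=
  (abs_nonneg _).trans (hlip { V := Unit, edges := 0 } () ())

lemma lip_add (hlip : GraphParam.Lipschitz f κ) {V : Type} [Fintype V] (s E : Multiset (Sym2 V)) :
    |f { V := V, edges := s + E } - f { V := V, edges := E }| ≤ κ * s.card := by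
  induction s using Multiset.induction with
  | empty => simp
  | cons p s ih =>
    induction p with | _ a b =>
    have := hlip { V := V, edges := s + E } a b
    simp only [Multigraph.addEdge] at this
    rw [Multiset.cons_add, Multiset.card_cons]
    push_cast
    rw [abs_le] at *
    constructor <;> linarith [this.1, this.2, ih.1, ih.2]

lemma filter_card_le {W : Type} {m : Finset (Sym2 W)} (h : IsPairMatching m) (w : W) :
    (m.filter (fun p => w ∈ p)).card ≤ 1 := by
  rw [Finset.card_le_one]
  intro p hp q hq
  rw [Finset.mem_filter] at hp hq
  by_contra hpq
  exact h.2 p hp.1 q hq.1 hpq w hp.2 hq.2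

lemma lip_one (hlip : GraphParam.Lipschitz f κ) {V W : Type} [Fintype V] {m : Finset (Sym2 W)}
    (h : IsPairMatching m) (l l' : W → V) (w : W) (hl : ∀ x, x ≠ w → l x = l' x) :
    |f { V := V, edges := m.val.map (Sym2.map l) } - f { V := V, edges := m.val.map (Sym2.map l') }|
      ≤ 2 * κ := by
  have hsplit : m.val = (m.filter (fun p => w ∈ p)).val + (m.filter (fun p => w ∉ p)).val := by
    simp only [Finset.filter_val]
    exact (Multiset.filter_add_not _ _).symm
  have heq : (m.filter (fun p => w ∉ p)).val.map (Sym2.map l) =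
      (m.filter (fun p => w ∉ p)).val.map (Sym2.map l') := by
    refine Multiset.map_congr rfl fun p hp => ?_
    have hp' : w ∉ p := (Finset.mem_filter.1 hp).2
    refine Sym2.map_congr fun x hx => hl x ?_
    rintro rfl
    exact hp' hx
  rw [hsplit, Multiset.map_add, Multiset.map_add, heq]
  have h1 := lip_add hlip ((m.filter (fun p => w ∈ p)).val.map (Sym2.map l))
    ((m.filter (fun p => w ∉ p)).val.map (Sym2.map l'))
  have h2 := lip_add hlip ((m.filter (fun p => w ∈ p)).val.map (Sym2.map l'))
    ((m.filter (fun p => w ∉ p)).val.map (Sym2.map l'))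
  have hk := kappa_nonneg hlip
  have h3 : κ * ((m.filter (fun p => w ∈ p)).card : ℝ) ≤ κ * 1 :=
    mul_le_mul_of_nonneg_left (by exact_mod_cast filter_card_le h w) hk
  rw [Multiset.card_map] at h1 h2
  change _ ≤ κ * ((m.filter (fun p => w ∈ p)).card : ℝ) at h1
  change _ ≤ κ * ((m.filter (fun p => w ∈ p)).card : ℝ) at h2
  rw [abs_le] at *
  constructor <;> linarith [h1.1, h1.2, h2.1, h2.2]

lemma lip_two (hlip : GraphParam.Lipschitz f κ) {V W : Type} [Fintype V] {m : Finset (Sym2 W)}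
    (h : IsPairMatching m) (l l' : W → V) (p q : W) (hl : ∀ x, x ≠ p → x ≠ q → l x = l' x) :
    |f { V := V, edges := m.val.map (Sym2.map l) } - f { V := V, edges := m.val.map (Sym2.map l') }|
      ≤ 4 * κ := by
  have h1 := lip_one hlip h l (Function.update l p (l' p)) p (by
    intro x hx; rw [Function.update_of_ne hx])
  have h2 := lip_one hlip h (Function.update l p (l' p)) l' q (by
    intro x hx
    by_cases hxp : x = p
    · subst hxp; simp
    · rw [Function.update_of_ne hxp]; exact hl x hxp hx)
  rw [abs_le] at *
  constructor <;> linarith [h1.1, h1.2, h2.1, h2.2]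

lemma extra_card {W : Type} {m₀ : Finset (Sym2 W)} (h₀ : IsMaximalMatching m₀)
    {m : Finset (Sym2 (Option W))} (h : IsPairMatching m)
    (hsub : m₀.map (smap Function.Embedding.some) ⊆ m) :
    (m \ m₀.map (smap Function.Embedding.some)).card ≤ 1 := by
  have key : m \ m₀.map (smap Function.Embedding.some) ⊆ m.filter (fun p => none ∈ p) := by
    intro p hp
    rw [Finset.mem_sdiff] at hp
    refine Finset.mem_filter.2 ⟨hp.1, ?_⟩
    by_contra hn
    apply hp.2
    induction p with | _ a b =>
    obtain ⟨a, rfl⟩ : ∃ a', a = some a' := by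
      cases a with
      | none => exact absurd (by simp) hn
      | some a => exact ⟨a, rfl⟩
    obtain ⟨b, rfl⟩ : ∃ b', b = some b' := by
      cases b with
      | none => exact absurd (by simp) hn
      | some b => exact ⟨b, rfl⟩
    refine Finset.mem_map.2 ⟨s(a, b), ?_, rfl⟩
    have hi : IsPairMatching (insert s(a, b) m₀) := by
      apply pm_of_map Function.Embedding.some
      rw [Finset.map_insert]
      have hss : insert (smap Function.Embedding.some s(a, b))
          (m₀.map (smap Function.Embedding.some)) ⊆ m := by
        intro q hq
        rcases Finset.mem_insert.1 hq with rfl | hq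
        · exact hp.1
        · exact hsub hq
      exact ⟨fun q hq => h.1 q (hss hq), fun q hq r hr => h.2 q (hss hq) r (hss hr)⟩
    rw [← h₀.2 _ hi (Finset.subset_insert _ _)]
    exact Finset.mem_insert_self _ _
  refine (Finset.card_le_card key).trans (le_trans (le_of_eq ?_) (filter_card_le h none))
  congr

set_option maxHeartbeats 800000 in
lemma option_lip (hlip : GraphParam.Lipschitz f κ) {V W : Type} [Fintype V] [Fintype W]
    (l : Option W → V) : |A f l - A f (fun w => l (some w))| ≤ 5 * κ := by
  have hk := kappa_nonneg hlip
  obtain ⟨m₀, h₀⟩ := exists_mm W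
  obtain ⟨m, hsub, hm⟩ := exists_maximal (pm_map Function.Embedding.some h₀.1)
  have hcard := extra_card h₀ hm.1 hsub
  have hval : m.val = (m \ m₀.map (smap Function.Embedding.some)).val +
      (m₀.map (smap Function.Embedding.some)).val := by
    rw [Finset.sdiff_val]
    exact (tsub_add_cancel_of_le (Finset.val_le_iff.2 hsub)).symm
  rw [A_eq_perm f l hm, A_eq_perm f _ h₀]
  set F : (Option W → V) → ℝ := fun l => f { V := V, edges := m.val.map (Sym2.map l) } with hF
  set F₀ : (W → V) → ℝ := fun l => f { V := V, edges := m₀.val.map (Sym2.map l) } with hF₀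
  have hstep : ∀ (x : Option W) (τ : Equiv.Perm W),
      |F (l ∘ (Equiv.Perm.decomposeOption.symm (x, τ))) - F₀ ((fun w => l (some w)) ∘ τ)|
        ≤ 5 * κ := by
    intro x τ
    have h1 : |F (l ∘ (Equiv.Perm.decomposeOption.symm (x, τ))) - F (l ∘ (Equiv.optionCongr τ))|
        ≤ 4 * κ := by
      refine lip_two hlip hm.1 _ _ none ((Equiv.optionCongr τ).symm x) ?_
      intro y hy hy'
      simp only [Equiv.Perm.decomposeOption_symm_apply, Function.comp, Equiv.Perm.mul_apply]
      rw [Equiv.swap_apply_of_ne_of_ne]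
      · cases y with
        | none => exact absurd rfl hy
        | some y => simp
      · intro h
        exact hy' ((Equiv.eq_symm_apply _).2 h)
    have h2 : |F (l ∘ (Equiv.optionCongr τ)) - F₀ ((fun w => l (some w)) ∘ τ)| ≤ κ := by
      have e1 : (m₀.map (smap Function.Embedding.some)).val.map
          (Sym2.map (l ∘ (Equiv.optionCongr τ))) =
          m₀.val.map (Sym2.map ((fun w => l (some w)) ∘ τ)) := by
        simp only [Finset.map_val, Multiset.map_map]
        congr 1
        ext p
        induction p with | _ a b => simp
      have h3 := lip_add hlip ((m \ m₀.map (smap Function.Embedding.some)).val.map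
        (Sym2.map (l ∘ (Equiv.optionCongr τ)))) (m₀.val.map (Sym2.map ((fun w => l (some w)) ∘ τ)))
      rw [← e1, ← Multiset.map_add, ← hval, Multiset.card_map, e1] at h3
      refine h3.trans ?_
      have : κ * ((m \ m₀.map (smap Function.Embedding.some)).card : ℝ) ≤ κ * 1 :=
        mul_le_mul_of_nonneg_left (by exact_mod_cast hcard) hk
      rw [mul_one] at this
      exact this
    rw [abs_le] at *
    constructor <;> linarith [h1.1, h1.2, h2.1, h2.2]
  have e1 : ∑ τ : Equiv.Perm (Option W), F (l ∘ τ) =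
      ∑ x : Option W, ∑ τ : Equiv.Perm W, F (l ∘ (Equiv.Perm.decomposeOption.symm (x, τ))) := by
    rw [← Equiv.sum_comp Equiv.Perm.decomposeOption.symm, Fintype.sum_prod_type]
  have e2 : Fintype.card (Equiv.Perm (Option W)) =
      Fintype.card (Option W) * Fintype.card (Equiv.Perm W) := by
    rw [Fintype.card_congr Equiv.Perm.decomposeOption, Fintype.card_prod]
  have p1 : (0 : ℝ) < Fintype.card (Option W) := by exact_mod_cast Fintype.card_pos
  have p2 : (0 : ℝ) < Fintype.card (Equiv.Perm W) := by exact_mod_cast Fintype.card_pos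
  have e3 : (∑ τ : Equiv.Perm W, F₀ ((fun w => l (some w)) ∘ τ)) / (Fintype.card (Equiv.Perm W) : ℝ)
      = (∑ x : Option W, ∑ τ : Equiv.Perm W, F₀ ((fun w => l (some w)) ∘ τ)) /
        ((Fintype.card (Option W) : ℝ) * Fintype.card (Equiv.Perm W)) := by
    rw [Finset.sum_const, Finset.card_univ, nsmul_eq_mul, mul_div_mul_left _ _ p1.ne']
  change |(∑ τ : Equiv.Perm (Option W), F (l ∘ τ)) / _ -
    (∑ τ : Equiv.Perm W, F₀ ((fun w => l (some w)) ∘ τ)) / _| ≤ _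
  rw [e1, e2, e3]
  push_cast
  rw [← sub_div, ← Finset.sum_sub_distrib, abs_div, abs_of_pos (mul_pos p1 p2),
    div_le_iff₀ (mul_pos p1 p2)]
  refine (Finset.abs_sum_le_sum_abs _ _).trans ?_
  calc _ ≤ ∑ x : Option W, ∑ τ : Equiv.Perm W, 5 * κ := by
        refine Finset.sum_le_sum fun x _ => ?_
        rw [← Finset.sum_sub_distrib]
        exact (Finset.abs_sum_le_sum_abs _ _).trans (Finset.sum_le_sum fun τ _ => hstep x τ)
    _ = _ := by
        simp only [Finset.sum_const, Finset.card_univ, nsmul_eq_mul]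
        ring

lemma config_eq (f : Multigraph → ℝ) (V : Type) [Fintype V] [DecidableEq V] (d : V → ℕ) :
    configExpect V d f = A f (Sigma.fst : HalfEdge V d → V) := by
  have h : maximalMatchings V d = MM (HalfEdge V d) := by
    ext m
    simp [maximalMatchings, mem_MM]
  rw [configExpect, A, avg, h]
  rfl

lemma fiber_card {V : Type} [Fintype V] (d : V → ℕ) (v : V)
    [Fintype {w : HalfEdge V d // w.1 = v}] :
    Fintype.card {w : HalfEdge V d // w.1 = v} = d v := by
  rw [Fintype.card_congr (Equiv.sigmaSubtype v), Fintype.card_fin]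

lemma option_fiber_card {V W : Type} [Fintype W] (l : Option W → V) (v : V)
    [Fintype {o // l o = v}] [Fintype {w // l (some w) = v}] :
    Fintype.card {o // l o = v} =
      (if l none = v then 1 else 0) + Fintype.card {w // l (some w) = v} := by
  rw [Fintype.card_subtype, Fintype.card_subtype, Finset.card_filter, Finset.card_filter,
    Fintype.sum_option]

lemma config_single (hlip : GraphParam.Lipschitz f κ) {V : Type} [Fintype V] [DecidableEq V]
    (d : V → ℕ) (i : V) :
    |configExpect V (d + Pi.single i 1) f - configExpect V d f| ≤ 5 * κ := by
  rw [config_eq, config_eq]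
  have h : A f (Sigma.fst : HalfEdge V (d + Pi.single i 1) → V) =
      A f (fun o : Option (HalfEdge V d) => o.elim i Sigma.fst) := by
    apply A_fiber
    intro v
    rw [option_fiber_card, fiber_card]
    have h1 : Fintype.card {w : HalfEdge V d //
        (fun o : Option (HalfEdge V d) => o.elim i Sigma.fst) (some w) = v} = d v :=
      fiber_card d v
    rw [h1, Pi.add_apply, add_comm]
    congr 1
    by_cases h : i = v
    · subst h; simp
    · rw [if_neg (show ¬ (none : Option (HalfEdge V d)).elim i Sigma.fst = v from h),
        Pi.single_apply, if_neg (fun h' => h h'.symm)]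
  rw [h]
  exact option_lip hlip (fun o : Option (HalfEdge V d) => o.elim i Sigma.fst)

lemma config_up (hlip : GraphParam.Lipschitz f κ) {V : Type} [Fintype V] [DecidableEq V]
    (N : ℕ) : ∀ (d e : V → ℕ), ∑ i, e i = N →
    |configExpect V (d + e) f - configExpect V d f| ≤ 5 * κ * N := by
  induction N with
  | zero =>
    intro d e he
    have : e = 0 := by
      ext i
      exact (Finset.sum_eq_zero_iff.1 he) i (Finset.mem_univ i)
    simp [this]
  | succ N ih =>
    intro d e he
    obtain ⟨i, hi⟩ : ∃ i, e i ≠ 0 := by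
      by_contra hcon
      push Not at hcon
      simp [hcon] at he
    obtain ⟨e', rfl⟩ : ∃ e' : V → ℕ, e = e' + Pi.single i 1 := by
      refine ⟨e - Pi.single i 1, ?_⟩
      funext j
      change e j = e j - (Pi.single i 1 : V → ℕ) j + (Pi.single i 1 : V → ℕ) j
      rw [Pi.single_apply]
      split_ifs with hj
      · subst hj; omega
      · rfl
    have hs : ∑ i, e' i = N := by
      simp only [Pi.add_apply, Finset.sum_add_distrib, Finset.sum_pi_single', Finset.mem_univ,
        if_true] at he
      simpa using he
    have h1 := ih d e' hs
    have h2 := config_single hlip (d + e') i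
    rw [← add_assoc]
    push_cast
    rw [abs_le] at *
    constructor <;> linarith [h1.1, h1.2, h2.1, h2.2]

lemma config_l1 (hlip : GraphParam.Lipschitz f κ) {V : Type} [Fintype V] [DecidableEq V]
    (d d' : V → ℕ) :
    |configExpect V d f - configExpect V d' f| ≤ 5 * κ * ∑ i, |(d i : ℝ) - d' i| := by
  have h1 := config_up hlip _ (d ⊓ d') (d - d ⊓ d') rfl
  have h2 := config_up hlip _ (d ⊓ d') (d' - d ⊓ d') rfl
  have e1 : d ⊓ d' + (d - d ⊓ d') = d := by ext i; simp
  have e2 : d ⊓ d' + (d' - d ⊓ d') = d' := by ext i; simp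
  have e3 : (∑ i, |(d i : ℝ) - d' i|) = ((∑ i, (d - d ⊓ d') i : ℕ) : ℝ) +
      ((∑ i, (d' - d ⊓ d') i : ℕ) : ℝ) := by
    push_cast
    rw [← Finset.sum_add_distrib]
    refine Finset.sum_congr rfl fun i _ => ?_
    rcases le_total (d i) (d' i) with h | h
    · have h' : (d i : ℝ) ≤ d' i := by exact_mod_cast h
      rw [abs_of_nonpos (by linarith)]
      simp [h]
    · have h' : (d' i : ℝ) ≤ d i := by exact_mod_cast h
      rw [abs_of_nonneg (by linarith)]
      simp [h]
  rw [e1] at h1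
  rw [e2] at h2
  rw [e3, mul_add]
  rw [abs_le] at *
  constructor <;> linarith [h1.1, h1.2, h2.1, h2.2]

lemma config_perm (hinv : GraphParam.Invariant f) {V : Type} [Fintype V] [DecidableEq V]
    (d : V → ℕ) (π : Equiv.Perm V) : configExpect V (d ∘ π) f = configExpect V d f := by
  rw [config_eq, config_eq, ← A_rename f hinv (Sigma.fst : HalfEdge V (d ∘ π) → V) π]
  apply A_fiber
  intro v
  have : ∀ w : HalfEdge V (d ∘ π), (⇑π ∘ Sigma.fst) w = v ↔ w.1 = π.symm v := by
    intro w
    simp [Equiv.eq_symm_apply]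
  have h1 : Fintype.card {w : HalfEdge V (d ∘ π) // (⇑π ∘ Sigma.fst) w = v} = d v := by
    refine ((Fintype.card_congr (Equiv.subtypeEquivRight this)).trans
      (fiber_card (d ∘ π) (π.symm v))).trans ?_
    simp
  have h2 := fiber_card d v
  rw [← h1] at h2
  rw [Fintype.card_eq_nat_card, Fintype.card_eq_nat_card] at h2 ⊢
  exact h2

end lip

/-- number of indices with value `k` -/
noncomputable def cnt {n : ℕ} (d : Fin n → ℕ) (k : ℕ) : ℕ := (Finset.univ.filter fun i => d i = k).card

lemma sum_mul_cnt {n : ℕ} (d : Fin n → ℕ) (M : ℕ) (hM : ∀ i, d i < M) (p : Fin n → Prop)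
    [DecidablePred p] :
    ∑ k ∈ Finset.range M, (k : ℝ) * ((Finset.univ.filter fun i => p i ∧ d i = k).card : ℝ) =
      ∑ i, if p i then (d i : ℝ) else 0 := by
  have : ∀ k : ℕ, (k : ℝ) * ((Finset.univ.filter fun i => p i ∧ d i = k).card : ℝ) =
      ∑ i, if d i = k then (if p i then (d i : ℝ) else 0) else 0 := by
    intro k
    rw [Finset.card_filter]
    push_cast
    rw [Finset.mul_sum]
    refine Finset.sum_congr rfl fun i _ => ?_
    by_cases h1 : d i = k <;> by_cases h2 : p i <;> simp [h1, h2]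
  rw [Finset.sum_congr rfl fun k _ => this k]
  rw [Finset.sum_comm]
  refine Finset.sum_congr rfl fun i _ => ?_
  rw [Finset.sum_ite_eq]
  simp [hM i]

lemma exists_perm {n : ℕ} (D d : Fin n → ℕ) (M : ℕ) (hD : ∀ i, D i < M) (hd : ∀ i, d i < M) :
    ∃ π : Equiv.Perm (Fin n), ∑ i, |((D ∘ π) i : ℝ) - d i| ≤
      ∑ k ∈ Finset.range M, (k : ℝ) * |(cnt D k : ℝ) - cnt d k| := by
  obtain ⟨π, hπ⟩ := Finite.exists_max (fun π : Equiv.Perm (Fin n) =>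
    (Finset.univ.filter fun i => D (π i) = d i).card)
  refine ⟨π, ?_⟩
  have key : ∀ i j, D (π i) ≠ d i → D (π j) ≠ d j → D (π i) ≠ d j := by
    intro i j hi hj hij
    have hne : i ≠ j := by rintro rfl; exact hi hij
    have h1 := hπ (π * Equiv.swap i j)
    have h2 : insert j (Finset.univ.filter fun i => D (π i) = d i) ⊆
        Finset.univ.filter fun a => D ((π * Equiv.swap i j) a) = d a := by
      intro a ha
      rw [Finset.mem_filter]
      refine ⟨Finset.mem_univ _, ?_⟩
      rcases Finset.mem_insert.1 ha with rfl | ha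
      · simpa using hij
      · have ha' := (Finset.mem_filter.1 ha).2
        rw [Equiv.Perm.mul_apply, Equiv.swap_apply_of_ne_of_ne]
        · exact ha'
        · rintro rfl; exact hi ha'
        · rintro rfl; exact hj ha'
    have h3 := Finset.card_le_card h2
    rw [Finset.card_insert_of_notMem (by simpa using hj)] at h3
    omega
  set uD : ℕ → ℕ := fun k => (Finset.univ.filter fun i => D (π i) ≠ d i ∧ (D ∘ π) i = k).card with huD
  set ud : ℕ → ℕ := fun k => (Finset.univ.filter fun i => D (π i) ≠ d i ∧ d i = k).card with hud
  have hcD : ∀ k, cnt D k = (Finset.univ.filter fun i => D (π i) = d i ∧ d i = k).card + uD k := by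
    intro k
    have : cnt D k = (Finset.univ.filter fun i => (D ∘ π) i = k).card := by
      symm
      refine Finset.card_bij (fun i _ => π i) ?_ ?_ ?_
      · intro i hi; simpa using hi
      · intro a _ b _ h; exact π.injective h
      · intro b hb
        exact ⟨π.symm b, by simpa using hb, by simp⟩
    rw [this, huD, ← Finset.card_union_of_disjoint]
    · congr 1
      ext i
      simp only [Finset.mem_filter, Finset.mem_union, Finset.mem_univ, true_and, Function.comp]
      grind
    · rw [Finset.disjoint_filter]
      intro i _ h1 h2
      exact h2.1 h1.1
  have hcd : ∀ k, cnt d k = (Finset.univ.filter fun i => D (π i) = d i ∧ d i = k).card + ud k := by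
    intro k
    rw [cnt, hud, ← Finset.card_union_of_disjoint]
    · congr 1
      ext i
      simp only [Finset.mem_filter, Finset.mem_union, Finset.mem_univ, true_and]
      grind
    · rw [Finset.disjoint_filter]
      intro i _ h1 h2
      exact h2.1 h1.1
  have hz : ∀ k, uD k = 0 ∨ ud k = 0 := by
    intro k
    by_contra hcon
    push Not at hcon
    obtain ⟨i, hi⟩ := Finset.card_ne_zero.1 hcon.1
    obtain ⟨j, hj⟩ := Finset.card_ne_zero.1 hcon.2
    simp only [Finset.mem_filter, Finset.mem_univ, true_and] at hi hj
    exact key i j hi.1 hj.1 (hi.2.trans hj.2.symm)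
  have hu : ∀ k, |(cnt D k : ℝ) - cnt d k| = uD k + ud k := by
    intro k
    rw [hcD, hcd]
    push_cast
    rcases hz k with h | h <;> rw [h] <;> simp
  simp_rw [hu, mul_add]
  have s1 := sum_mul_cnt (D ∘ π) M (fun i => hD _) (fun i => D (π i) ≠ d i)
  have s2 := sum_mul_cnt d M hd (fun i => D (π i) ≠ d i)
  have s1' : ∑ k ∈ Finset.range M, (k : ℝ) * uD k = _ := s1
  have s2' : ∑ k ∈ Finset.range M, (k : ℝ) * ud k = _ := s2
  rw [Finset.sum_add_distrib, s1', s2', ← Finset.sum_add_distrib]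
  refine Finset.sum_le_sum fun i _ => ?_
  by_cases h : D (π i) = d i
  · simp [h]
  · simp only [Function.comp, ne_eq, h, not_false_eq_true, if_true]
    rw [abs_le]
    have h1 : (0:ℝ) ≤ D (π i) := by positivity
    have h2 : (0:ℝ) ≤ d i := by positivity
    constructor <;> linarith

lemma sum_eq_cnt {n : ℕ} (d : Fin n → ℕ) (M : ℕ) (hM : ∀ i, d i < M) :
    ∑ k ∈ Finset.range M, (k : ℝ) * cnt d k = ∑ i, (d i : ℝ) := by
  have := sum_mul_cnt d M hM (fun _ => True)
  simpa [cnt] using this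

/-- Comparison of two configuration models through truncated degree counts. -/
lemma config_compare {f : Multigraph → ℝ} {κ : ℝ} (hinv : GraphParam.Invariant f)
    (hlip : GraphParam.Lipschitz f κ) {n : ℕ} (D d : Fin n → ℕ) (K : ℕ) :
    |configExpect (Fin n) D f - configExpect (Fin n) d f| ≤
      5 * κ * (∑ k ∈ Finset.range K, (k : ℝ) * |(cnt D k : ℝ) - cnt d k| +
        (∑ i, (D i : ℝ) - ∑ k ∈ Finset.range K, (k : ℝ) * cnt D k) +
        (∑ i, (d i : ℝ) - ∑ k ∈ Finset.range K, (k : ℝ) * cnt d k)) := by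
  set M := K + (∑ i, (D i + 1)) + (∑ i, (d i + 1)) with hM
  have hD : ∀ i, D i < M := by
    intro i
    have := Finset.single_le_sum (f := fun i => D i + 1) (fun _ _ => Nat.zero_le _) (Finset.mem_univ i)
    omega
  have hd : ∀ i, d i < M := by
    intro i
    have := Finset.single_le_sum (f := fun i => d i + 1) (fun _ _ => Nat.zero_le _) (Finset.mem_univ i)
    omega
  have hKM : K ≤ M := by omega
  obtain ⟨π, hπ⟩ := exists_perm D d M hD hd
  rw [← config_perm hinv D π]
  refine (config_l1 hlip _ _).trans ?_
  refine mul_le_mul_of_nonneg_left (hπ.trans ?_) (by have := kappa_nonneg hlip; positivity)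
  rw [← sum_eq_cnt D M hD, ← sum_eq_cnt d M hd, ← Finset.sum_range_add_sum_Ico _ hKM,
    ← Finset.sum_range_add_sum_Ico (fun k => (k : ℝ) * cnt D k) hKM,
    ← Finset.sum_range_add_sum_Ico (fun k => (k : ℝ) * cnt d k) hKM]
  have : ∑ k ∈ Finset.Ico K M, (k : ℝ) * |(cnt D k : ℝ) - cnt d k| ≤
      ∑ k ∈ Finset.Ico K M, ((k : ℝ) * cnt D k + (k : ℝ) * cnt d k) := by
    refine Finset.sum_le_sum fun k _ => ?_
    rw [← mul_add]
    refine mul_le_mul_of_nonneg_left ?_ (by positivity)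
    refine (abs_sub _ _).trans ?_
    simp
  rw [Finset.sum_add_distrib] at this
  linarith

end CM

namespace CM

section prob

variable {μ : ℕ → ℝ}

lemma hasSum_ofReal (hμ0 : ∀ k, 0 ≤ μ k) (hμ1 : HasSum μ 1) :
    HasSum (fun k => ENNReal.ofReal (μ k)) 1 := by
  have h := ENNReal.ofReal_tsum_of_nonneg hμ0 hμ1.summable
  rw [hμ1.tsum_eq, ENNReal.ofReal_one] at h
  rw [h]
  exact ENNReal.summable.hasSum

/-- the degree law as a PMF -/
noncomputable def lawPMF (hμ0 : ∀ k, 0 ≤ μ k) (hμ1 : HasSum μ 1) : PMF ℕ :=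
  ⟨fun k => ENNReal.ofReal (μ k), hasSum_ofReal hμ0 hμ1⟩

/-- the degree law as a measure -/
noncomputable def law (hμ0 : ∀ k, 0 ≤ μ k) (hμ1 : HasSum μ 1) : Measure ℕ :=
  (lawPMF hμ0 hμ1).toMeasure

instance (hμ0 : ∀ k, 0 ≤ μ k) (hμ1 : HasSum μ 1) : IsProbabilityMeasure (law hμ0 hμ1) := by
  unfold law; infer_instance

lemma law_singleton (hμ0 : ∀ k, 0 ≤ μ k) (hμ1 : HasSum μ 1) (k : ℕ) :
    law hμ0 hμ1 {k} = ENNReal.ofReal (μ k) := by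
  unfold law
  rw [PMF.toMeasure_apply_singleton _ _ (measurableSet_singleton k)]
  rfl

lemma integrable_id (hμ0 : ∀ k, 0 ≤ μ k) (hμ1 : HasSum μ 1)
    (hμmean : Summable fun k : ℕ => (k : ℝ) * μ k) :
    Integrable (fun k : ℕ => (k : ℝ)) (law hμ0 hμ1) := by
  refine ⟨Measurable.of_discrete.aestronglyMeasurable, ?_⟩
  rw [hasFiniteIntegral_iff_norm, lintegral_countable']
  have : ∀ k : ℕ, ENNReal.ofReal ‖(k : ℝ)‖ * law hμ0 hμ1 {k} = ENNReal.ofReal ((k : ℝ) * μ k) := by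
    intro k
    rw [law_singleton, ENNReal.ofReal_mul (by positivity)]
    simp
  simp_rw [this]
  rw [← ENNReal.ofReal_tsum_of_nonneg (fun k => mul_nonneg (by positivity) (hμ0 k)) hμmean]
  exact ENNReal.ofReal_lt_top

lemma integral_id (hμ0 : ∀ k, 0 ≤ μ k) (hμ1 : HasSum μ 1)
    (hμmean : Summable fun k : ℕ => (k : ℝ) * μ k) :
    ∫ k, (k : ℝ) ∂(law hμ0 hμ1) = ∑' k : ℕ, (k : ℝ) * μ k := by
  rw [integral_countable (integrable_id hμ0 hμ1 hμmean)]
  congr 1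
  ext k
  rw [measureReal_def, law_singleton, ENNReal.toReal_ofReal (hμ0 k), smul_eq_mul, mul_comm]

/-- indicator of `k` -/
noncomputable def ind (k : ℕ) : ℕ → ℝ := fun x => if x = k then 1 else 0

lemma ind_memLp (hμ0 : ∀ k, 0 ≤ μ k) (hμ1 : HasSum μ 1) (k : ℕ) : MemLp (ind k) 2 (law hμ0 hμ1) := by
  refine MemLp.of_bound Measurable.of_discrete.aestronglyMeasurable 1 (ae_of_all _ fun x => ?_)
  unfold ind
  split_ifs <;> simp

lemma ind_integral (hμ0 : ∀ k, 0 ≤ μ k) (hμ1 : HasSum μ 1) (k : ℕ) :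
    ∫ x, ind k x ∂(law hμ0 hμ1) = μ k := by
  have : ind k = Set.indicator {k} (fun _ => (1 : ℝ)) := by
    ext x; simp [ind, Set.indicator_apply]
  rw [this, integral_indicator (measurableSet_singleton k)]
  simp [measureReal_def, law_singleton, hμ0 k]

noncomputable def plaw (hμ0 : ∀ k, 0 ≤ μ k) (hμ1 : HasSum μ 1) (n : ℕ) : Measure (Fin n → ℕ) :=
  Measure.pi (fun _ => law hμ0 hμ1)

instance (hμ0 : ∀ k, 0 ≤ μ k) (hμ1 : HasSum μ 1) (n : ℕ) : IsProbabilityMeasure (plaw hμ0 hμ1 n) := by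
  unfold plaw; infer_instance

lemma plaw_singleton (hμ0 : ∀ k, 0 ≤ μ k) (hμ1 : HasSum μ 1) (n : ℕ) (D : Fin n → ℕ) :
    (plaw hμ0 hμ1 n).real {D} = ∏ i, μ (D i) := by
  unfold plaw
  rw [measureReal_def, Measure.pi_singleton, ENNReal.toReal_prod]
  refine Finset.prod_congr rfl fun i _ => ?_
  rw [law_singleton, ENNReal.toReal_ofReal (hμ0 _)]

lemma cnt_eq {n : ℕ} (k : ℕ) :
    (fun D : Fin n → ℕ => (cnt D k : ℝ)) = ∑ i : Fin n, fun D : Fin n → ℕ => ind k (D i) := by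
  ext D
  rw [Finset.sum_apply]
  simp [cnt, ind]

lemma cnt_memLp (hμ0 : ∀ k, 0 ≤ μ k) (hμ1 : HasSum μ 1) (n k : ℕ) :
    MemLp (fun D : Fin n → ℕ => (cnt D k : ℝ)) 2 (plaw hμ0 hμ1 n) := by
  refine MemLp.of_bound Measurable.of_discrete.aestronglyMeasurable n (ae_of_all _ fun x => ?_)
  rw [Real.norm_eq_abs, abs_of_nonneg (by positivity)]
  have : cnt x k ≤ n := by
    unfold cnt
    refine (Finset.card_le_univ _).trans ?_
    simp
  exact_mod_cast this

lemma cnt_integral (hμ0 : ∀ k, 0 ≤ μ k) (hμ1 : HasSum μ 1) (n k : ℕ) :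
    ∫ D : Fin n → ℕ, (cnt D k : ℝ) ∂(plaw hμ0 hμ1 n) = n * μ k := by
  have hc : ∀ D : Fin n → ℕ, (cnt D k : ℝ) = ∑ i, ind k (D i) := by
    intro D
    simp [cnt, ind]
  simp_rw [hc]
  unfold plaw
  rw [integral_finsetSum]
  · rw [Finset.sum_congr rfl (g := fun _ => μ k)]
    · simp
    · intro i _
      rw [integral_comp_eval (μ := fun _ => law hμ0 hμ1) (f := ind k)
        Measurable.of_discrete.aestronglyMeasurable, ind_integral]
  · intro i _
    exact integrable_comp_eval (μ := fun _ => law hμ0 hμ1) (f := ind k)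
      ((ind_memLp hμ0 hμ1 k).integrable (by norm_num))

lemma cnt_variance (hμ0 : ∀ k, 0 ≤ μ k) (hμ1 : HasSum μ 1) (n k : ℕ) :
    ProbabilityTheory.variance (fun D : Fin n → ℕ => (cnt D k : ℝ)) (plaw hμ0 hμ1 n) ≤ n := by
  rw [cnt_eq]
  unfold plaw
  rw [ProbabilityTheory.variance_sum_pi (X := fun _ => ind k) (fun _ => ind_memLp hμ0 hμ1 k)]
  have h1 : ProbabilityTheory.variance (ind k) (law hμ0 hμ1) ≤ 1 := by
    refine (ProbabilityTheory.variance_le_expectation_sq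
      Measurable.of_discrete.aestronglyMeasurable).trans ?_
    have : (ind k) ^ 2 = ind k := by
      ext x
      simp only [Pi.pow_apply, ind]
      split_ifs <;> simp
    rw [this, ind_integral, ← hμ1.tsum_eq]
    exact hμ1.summable.le_tsum k (fun j _ => hμ0 j)
  simp only [Finset.sum_const, Finset.card_univ, Fintype.card_fin, nsmul_eq_mul]
  nlinarith [(Nat.cast_nonneg n : (0:ℝ) ≤ n)]

lemma cnt_dev (hμ0 : ∀ k, 0 ≤ μ k) (hμ1 : HasSum μ 1) (n k : ℕ) :
    ∫ D : Fin n → ℕ, |(cnt D k : ℝ) - n * μ k| ∂(plaw hμ0 hμ1 n) ≤ Real.sqrt n := by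
  have hL : MemLp (fun D : Fin n → ℕ => |(cnt D k : ℝ) - n * μ k|) 2 (plaw hμ0 hμ1 n) :=
    ((cnt_memLp hμ0 hμ1 n k).sub (memLp_const _)).abs
  have h1 := ProbabilityTheory.variance_nonneg
    (fun D : Fin n → ℕ => |(cnt D k : ℝ) - n * μ k|) (plaw hμ0 hμ1 n)
  rw [ProbabilityTheory.variance_eq_sub hL] at h1
  have h2 := cnt_variance hμ0 hμ1 n k
  rw [ProbabilityTheory.variance_eq_integral Measurable.of_discrete.aemeasurable,
    cnt_integral] at h2
  simp only [Pi.pow_apply, sq_abs] at h1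
  apply Real.le_sqrt_of_sq_le
  linarith

lemma total_integrable (hμ0 : ∀ k, 0 ≤ μ k) (hμ1 : HasSum μ 1)
    (hμmean : Summable fun k : ℕ => (k : ℝ) * μ k) (n : ℕ) :
    Integrable (fun D : Fin n → ℕ => ∑ i, (D i : ℝ)) (plaw hμ0 hμ1 n) := by
  unfold plaw
  refine integrable_finsetSum _ fun i _ => ?_
  exact integrable_comp_eval (μ := fun _ => law hμ0 hμ1) (f := fun k : ℕ => (k : ℝ))
      (integrable_id hμ0 hμ1 hμmean)

lemma total_integral (hμ0 : ∀ k, 0 ≤ μ k) (hμ1 : HasSum μ 1)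
    (hμmean : Summable fun k : ℕ => (k : ℝ) * μ k) (n : ℕ) :
    ∫ D : Fin n → ℕ, ∑ i, (D i : ℝ) ∂(plaw hμ0 hμ1 n) = n * ∑' k : ℕ, (k : ℝ) * μ k := by
  unfold plaw
  rw [integral_finsetSum]
  · rw [Finset.sum_congr rfl (g := fun _ => ∑' k : ℕ, (k : ℝ) * μ k)]
    · simp
    · intro i _
      rw [integral_comp_eval (μ := fun _ => law hμ0 hμ1) (f := fun k : ℕ => (k : ℝ))
        Measurable.of_discrete.aestronglyMeasurable, integral_id hμ0 hμ1 hμmean]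
  · intro i _
    exact integrable_comp_eval (μ := fun _ => law hμ0 hμ1) (f := fun k : ℕ => (k : ℝ))
      (integrable_id hμ0 hμ1 hμmean)

variable {f : Multigraph → ℝ} {κ : ℝ}

lemma config_integrable (hlip : GraphParam.Lipschitz f κ)
    (hμ0 : ∀ k, 0 ≤ μ k) (hμ1 : HasSum μ 1)
    (hμmean : Summable fun k : ℕ => (k : ℝ) * μ k) (n : ℕ) :
    Integrable (fun D : Fin n → ℕ => configExpect (Fin n) D f) (plaw hμ0 hμ1 n) := by
  have hI : Integrable (fun D : Fin n → ℕ => 5 * κ * (∑ i, (D i : ℝ)) + |configExpect (Fin n) 0 f|)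
      (plaw hμ0 hμ1 n) :=
    ((total_integrable hμ0 hμ1 hμmean n).const_mul _).add (integrable_const _)
  refine hI.mono' Measurable.of_discrete.aestronglyMeasurable (ae_of_all _ fun D => ?_)
  have h := config_l1 hlip D 0
  have h2 : ∑ i, |(D i : ℝ) - ((0 : Fin n → ℕ) i : ℝ)| = ∑ i, (D i : ℝ) := by
    refine Finset.sum_congr rfl fun i _ => ?_
    simp
  rw [h2] at h
  rw [Real.norm_eq_abs]
  have := abs_sub_abs_le_abs_sub (configExpect (Fin n) D f) (configExpect (Fin n) 0 f)
  linarith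

lemma iid_eq (hlip : GraphParam.Lipschitz f κ)
    (hμ0 : ∀ k, 0 ≤ μ k) (hμ1 : HasSum μ 1)
    (hμmean : Summable fun k : ℕ => (k : ℝ) * μ k) (n : ℕ) :
    iidExpect μ n f = ∫ D : Fin n → ℕ, configExpect (Fin n) D f ∂(plaw hμ0 hμ1 n) := by
  rw [integral_countable (config_integrable hlip hμ0 hμ1 hμmean n), iidExpect]
  congr 1
  ext D
  rw [plaw_singleton, smul_eq_mul]

lemma iid_compare (hinv : GraphParam.Invariant f) (hlip : GraphParam.Lipschitz f κ)
    (hμ0 : ∀ k, 0 ≤ μ k) (hμ1 : HasSum μ 1)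
    (hμmean : Summable fun k : ℕ => (k : ℝ) * μ k) (n : ℕ) (d : Fin n → ℕ) (K : ℕ) :
    |iidExpect μ n f - configExpect (Fin n) d f| ≤
      5 * κ * (∑ k ∈ Finset.range K, (k : ℝ) * (Real.sqrt n + |n * μ k - cnt d k|) +
        (n * ∑' k : ℕ, (k : ℝ) * μ k - ∑ k ∈ Finset.range K, (k : ℝ) * (n * μ k)) +
        (∑ i, (d i : ℝ) - ∑ k ∈ Finset.range K, (k : ℝ) * cnt d k)) := by
  have hk := kappa_nonneg hlip
  have hint := config_integrable hlip hμ0 hμ1 hμmean n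
  have e1 : iidExpect μ n f - configExpect (Fin n) d f =
      ∫ D : Fin n → ℕ, (configExpect (Fin n) D f - configExpect (Fin n) d f) ∂(plaw hμ0 hμ1 n) := by
    rw [integral_sub hint (integrable_const _), iid_eq hlip hμ0 hμ1 hμmean]
    simp
  have hcnt : ∀ k, Integrable (fun D : Fin n → ℕ => (cnt D k : ℝ)) (plaw hμ0 hμ1 n) :=
    fun k => (cnt_memLp hμ0 hμ1 n k).integrable (by norm_num)
  have habs : ∀ k, Integrable (fun D : Fin n → ℕ => |(cnt D k : ℝ) - n * μ k|) (plaw hμ0 hμ1 n) :=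
    fun k => ((hcnt k).sub (integrable_const _)).abs
  have htot := total_integrable hμ0 hμ1 hμmean n
  have hS1 : Integrable (fun D : Fin n → ℕ => ∑ k ∈ Finset.range K, (k : ℝ) *
      (|(cnt D k : ℝ) - n * μ k| + |n * μ k - cnt d k|)) (plaw hμ0 hμ1 n) :=
    integrable_finsetSum _ fun k _ => ((habs k).add (integrable_const _)).const_mul _
  have hS2 : Integrable (fun D : Fin n → ℕ => ∑ k ∈ Finset.range K, (k : ℝ) * cnt D k)
      (plaw hμ0 hμ1 n) := integrable_finsetSum _ fun k _ => (hcnt k).const_mul _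
  have hS3 : Integrable (fun D : Fin n → ℕ => ∑ i, (D i : ℝ) -
      ∑ k ∈ Finset.range K, (k : ℝ) * cnt D k) (plaw hμ0 hμ1 n) := htot.sub hS2
  have hS4 : Integrable (fun D : Fin n → ℕ => ∑ k ∈ Finset.range K, (k : ℝ) *
      (|(cnt D k : ℝ) - n * μ k| + |n * μ k - cnt d k|) + (∑ i, (D i : ℝ) -
      ∑ k ∈ Finset.range K, (k : ℝ) * cnt D k)) (plaw hμ0 hμ1 n) := hS1.add hS3
  have hS5 : ∀ k : ℕ, Integrable (fun D : Fin n → ℕ => (k : ℝ) *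
      (|(cnt D k : ℝ) - n * μ k| + |n * μ k - cnt d k|)) (plaw hμ0 hμ1 n) :=
    fun k => ((habs k).add (integrable_const _)).const_mul _
  have hS6 : ∀ k : ℕ, Integrable (fun D : Fin n → ℕ => (k : ℝ) * (cnt D k : ℝ))
      (plaw hμ0 hμ1 n) := fun k => (hcnt k).const_mul _
  rw [e1]
  refine abs_integral_le_integral_abs.trans ?_
  have hle : ∫ D : Fin n → ℕ, |configExpect (Fin n) D f - configExpect (Fin n) d f|
      ∂(plaw hμ0 hμ1 n) ≤ ∫ D : Fin n → ℕ, 5 * κ * (∑ k ∈ Finset.range K, (k : ℝ) *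
        (|(cnt D k : ℝ) - n * μ k| + |n * μ k - cnt d k|) +
        (∑ i, (D i : ℝ) - ∑ k ∈ Finset.range K, (k : ℝ) * cnt D k) +
        (∑ i, (d i : ℝ) - ∑ k ∈ Finset.range K, (k : ℝ) * cnt d k)) ∂(plaw hμ0 hμ1 n) := by
    refine integral_mono (hint.sub (integrable_const _)).abs
      (((hS1.add (htot.sub hS2)).add (integrable_const _)).const_mul _) fun D => ?_
    refine (config_compare hinv hlip D d K).trans ?_
    refine mul_le_mul_of_nonneg_left ?_ (by positivity)
    gcongr with k _
    exact abs_sub_le _ _ _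
  refine hle.trans ?_
  rw [integral_const_mul]
  refine mul_le_mul_of_nonneg_left ?_ (by positivity)
  rw [integral_add hS4 (integrable_const _),
    integral_add hS1 hS3, integral_sub htot hS2, total_integral hμ0 hμ1 hμmean,
    integral_finsetSum _ (fun k _ => hS5 k),
    integral_finsetSum _ (fun k _ => hS6 k), integral_const, probReal_univ, one_smul]
  simp_rw [integral_const_mul, cnt_integral]
  gcongr with k _
  rw [integral_add (habs k) (integrable_const _), integral_const, probReal_univ, one_smul]
  gcongr
  exact cnt_dev hμ0 hμ1 n k

end prob
end CM

theorem statement13 (f : Multigraph → ℝ) (κ : ℝ)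
    (hinv : GraphParam.Invariant f) (hadd : GraphParam.Additive f)
    (hlip : GraphParam.Lipschitz f κ) (hconc : GraphParam.Concave f)
    (μ : ℕ → ℝ) (hμ0 : ∀ k, 0 ≤ μ k) (hμ1 : HasSum μ 1)
    (hμmean : Summable fun k : ℕ => (k : ℝ) * μ k)
    (Ψ : ℝ) (hΨ : Tendsto (fun n => iidExpect μ n f / (n : ℝ)) atTop (nhds Ψ))
    (d : (n : ℕ) → Fin n → ℕ) (hd : Approaches d μ) :
    Tendsto (fun n => configExpect (Fin n) (d n) f / (n : ℝ)) atTop (nhds Ψ) := by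
  have hk := CM.kappa_nonneg hlip
  set m : ℝ := ∑' k : ℕ, (k : ℝ) * μ k with hm
  have hemp : ∀ n k, empirical n (d n) k = (CM.cnt (d n) k : ℝ) / n := fun n k => rfl
  let B : ℕ → ℕ → ℝ := fun K n =>
    5 * κ * (∑ k ∈ Finset.range K, (k : ℝ) * (Real.sqrt n / n + |μ k - empirical n (d n) k|) +
        (m - ∑ k ∈ Finset.range K, (k : ℝ) * μ k) +
        ((∑ i, (d n i : ℝ)) / n - ∑ k ∈ Finset.range K, (k : ℝ) * empirical n (d n) k))
  have hB : ∀ K n, 0 < n → |iidExpect μ n f / n - configExpect (Fin n) (d n) f / n| ≤ B K n := by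
    intro K n hn
    have hn' : (0 : ℝ) < n := by exact_mod_cast hn
    have h := CM.iid_compare hinv hlip hμ0 hμ1 hμmean n (d n) K
    rw [← sub_div, abs_div, abs_of_pos hn', div_le_iff₀ hn']
    refine h.trans (le_of_eq ?_)
    simp only [B, hemp]
    rw [mul_assoc (5 * κ)]
    congr 1
    rw [add_mul, add_mul, sub_mul, sub_mul, div_mul_cancel₀ _ hn'.ne', Finset.sum_mul,
      Finset.sum_mul, Finset.sum_mul, mul_comm m]
    congr 1
    · congr 1
      · refine Finset.sum_congr rfl fun k _ => ?_
        rw [mul_assoc, add_mul, div_mul_cancel₀ _ hn'.ne', ← abs_of_pos hn', ← abs_mul,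
          abs_of_pos hn', sub_mul, div_mul_cancel₀ _ hn'.ne', mul_comm (μ k)]
      · congr 1
        refine Finset.sum_congr rfl fun k _ => ?_
        ring
    · congr 1
      refine Finset.sum_congr rfl fun k _ => ?_
      rw [mul_assoc, div_mul_cancel₀ _ hn'.ne']
  have hsqrt : Tendsto (fun n : ℕ => Real.sqrt n / n) atTop (nhds 0) := by
    have h1 : Tendsto (fun n : ℕ => (Real.sqrt n)⁻¹) atTop (nhds 0) :=
      tendsto_inv_atTop_zero.comp (Real.tendsto_sqrt_atTop.comp tendsto_natCast_atTop_atTop)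
    refine h1.congr fun n => ?_
    rw [Real.sqrt_div_self', one_div]
  have hBlim : ∀ K, Tendsto (B K) atTop
      (nhds (5 * κ * (∑ k ∈ Finset.range K, (k : ℝ) * (0 + |μ k - μ k|) +
        (m - ∑ k ∈ Finset.range K, (k : ℝ) * μ k) +
        (m - ∑ k ∈ Finset.range K, (k : ℝ) * μ k)))) := by
    intro K
    refine Tendsto.const_mul _ (Tendsto.add (Tendsto.add ?_ tendsto_const_nhds) (Tendsto.sub hd.2 ?_))
    · refine tendsto_finsetSum _ fun k _ => Tendsto.const_mul _ (hsqrt.add ?_)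
      exact (tendsto_const_nhds.sub (hd.1 k)).abs
    · exact tendsto_finsetSum _ fun k _ => Tendsto.const_mul _ (hd.1 k)
  have hdiff : Tendsto (fun n : ℕ => iidExpect μ n f / n - configExpect (Fin n) (d n) f / n) atTop
      (nhds 0) := by
    rw [Metric.tendsto_atTop']
    intro ε hε
    have hKlim : Tendsto (fun K => 5 * κ * (∑ k ∈ Finset.range K, (k : ℝ) * (0 + |μ k - μ k|) +
        (m - ∑ k ∈ Finset.range K, (k : ℝ) * μ k) +
        (m - ∑ k ∈ Finset.range K, (k : ℝ) * μ k))) atTop (nhds 0) := by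
      have h1 : Tendsto (fun K => m - ∑ k ∈ Finset.range K, (k : ℝ) * μ k) atTop (nhds (m - m)) :=
        tendsto_const_nhds.sub hμmean.hasSum.tendsto_sum_nat
      have h2 := (h1.add h1).const_mul (5 * κ)
      simpa using h2
    obtain ⟨K, hK⟩ := (hKlim.eventually (gt_mem_nhds hε)).exists
    obtain ⟨N, hN⟩ := eventually_atTop.1 ((hBlim K).eventually (gt_mem_nhds hK))
    refine ⟨N, fun n hn => ?_⟩
    rw [Real.dist_eq, sub_zero]
    exact (hB K n (by omega)).trans_lt (hN n hn.le)
  have := hΨ.sub hdiff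
  simpa using this
end

section
/- The independence number α is an additive, 1-Lipschitz, concave graph parameter. Moreover, for any finite multigraph G = (V, E), letting S ⊆ V be the intersection of all maximum independent sets of G, adding an edge between vertices i and j decreases the independence number by 1 if both i ∈ S and j ∈ S, and leaves it unchanged otherwise; in particular the increment matrix Δ^G_{ij} = α(G + ij) − α(G) equals −(𝟙_S 𝟙_S^T)_{ij} and is conditionally negative semidefinite. -/
open Finset Filter Topology MeasureTheory
open scoped Classical BigOperators ENNReal

/-- `t` is an independent set of `G` (no edge, including loops, between its vertices). -/
def IsIndepSet (G : Multigraph) (t : Finset G.V) : Prop :=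
  ∀ i ∈ t, ∀ j ∈ t, s(i, j) ∉ G.edges

/-- The independence number of `G`. -/
noncomputable def indepNumber (G : Multigraph) : ℕ :=
  (Finset.univ.filter fun t : Finset G.V => IsIndepSet G t).sup Finset.card

/-- The intersection of all maximum independent sets of `G`. -/
def indepCore (G : Multigraph) : Set G.V :=
  {v | ∀ t : Finset G.V, IsIndepSet G t → t.card = indepNumber G → v ∈ t}

/-- The independence number, as a real-valued graph parameter. -/
noncomputable def indepParam : Multigraph → ℝ := fun G => (indepNumber G : ℝ)

theorem aux_le (G : Multigraph) (t : Finset G.V) (h : IsIndepSet G t) :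
    t.card ≤ indepNumber G := by
  unfold indepNumber
  exact Finset.le_sup (f := Finset.card) (by simpa using h)

theorem aux_exists (G : Multigraph) :
    ∃ t : Finset G.V, IsIndepSet G t ∧ t.card = indepNumber G := by
  have hne : (Finset.univ.filter fun t : Finset G.V => IsIndepSet G t).Nonempty :=
    ⟨∅, Finset.mem_filter.2 ⟨Finset.mem_univ _, fun i hi => absurd hi (Finset.notMem_empty i)⟩⟩
  obtain ⟨t, ht, h⟩ := Finset.exists_mem_eq_sup _ hne Finset.card
  exact ⟨t, by simpa using ht, h.symm⟩

theorem aux_add (G : Multigraph) (i j : G.V) (t : Finset G.V) :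
    IsIndepSet (G.addEdge i j) t ↔ IsIndepSet G t ∧ ¬ (i ∈ t ∧ j ∈ t) := by
  constructor
  · intro h
    refine ⟨fun a ha b hb hab => h a ha b hb (Multiset.mem_cons_of_mem hab), ?_⟩
    rintro ⟨hi, hj⟩
    exact h i hi j hj (Multiset.mem_cons_self _ _)
  · rintro ⟨h, hij⟩ a ha b hb hab
    rcases Multiset.mem_cons.1 hab with h1 | h1
    · rcases Sym2.eq_iff.1 h1 with ⟨e1, e2⟩ | ⟨e1, e2⟩
      · exact hij ⟨e1 ▸ ha, e2 ▸ hb⟩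
      · exact hij ⟨e2 ▸ hb, e1 ▸ ha⟩
    · exact h a ha b hb h1

theorem aux_sub (G : Multigraph) (s t : Finset G.V) (hst : s ⊆ t) (h : IsIndepSet G t) :
    IsIndepSet G s := fun a ha b hb => h a (hst ha) b (hst hb)

theorem aux_inc (G : Multigraph) (i j : G.V) :
    indepParam (G.addEdge i j) =
      indepParam G - (if i ∈ indepCore G ∧ j ∈ indepCore G then 1 else 0) := by
  have hle : indepNumber (G.addEdge i j) ≤ indepNumber G := by
    obtain ⟨t, ht, hc⟩ := aux_exists (G.addEdge i j)
    rw [← hc]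
    exact aux_le G t ((aux_add G i j t).1 ht).1
  by_cases hS : i ∈ indepCore G ∧ j ∈ indepCore G
  · have hlt : indepNumber (G.addEdge i j) ≠ indepNumber G := by
      intro heq
      obtain ⟨t, ht, hc⟩ := aux_exists (G.addEdge i j)
      obtain ⟨h1, h2⟩ := (aux_add G i j t).1 ht
      have hc' := hc.trans heq
      exact h2 ⟨hS.1 t h1 hc', hS.2 t h1 hc'⟩
    have hge : indepNumber G ≤ indepNumber (G.addEdge i j) + 1 := by
      obtain ⟨t, ht, hc⟩ := aux_exists G
      have h1 : IsIndepSet (G.addEdge i j) (t.erase i) :=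
        (aux_add G i j _).2 ⟨aux_sub G _ t (Finset.erase_subset _ _) ht, by simp⟩
      have h2 := aux_le _ _ h1
      have h3 : t.card ≤ (t.erase i).card + 1 := by
        have := Finset.pred_card_le_card_erase (s := t) (a := i)
        omega
      rw [← hc]
      exact h3.trans (Nat.add_le_add_right h2 1)
    have heq : indepNumber G = indepNumber (G.addEdge i j) + 1 := by omega
    rw [if_pos hS]
    unfold indepParam
    rw [heq]
    push_cast
    ring
  · have hge : indepNumber G ≤ indepNumber (G.addEdge i j) := by
      have : ∃ t : Finset G.V, IsIndepSet G t ∧ t.card = indepNumber G ∧ ¬ (i ∈ t ∧ j ∈ t) := by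
        by_contra hcon
        push Not at hcon
        exact hS ⟨fun t h1 h2 => (hcon t h1 h2).1, fun t h1 h2 => (hcon t h1 h2).2⟩
      obtain ⟨t, ht, hc, hn⟩ := this
      rw [← hc]
      exact aux_le (G.addEdge i j) t ((aux_add G i j t).2 ⟨ht, hn⟩)
    rw [if_neg hS, sub_zero]
    unfold indepParam
    rw [le_antisymm hle hge]

/-- Pulling back a graph along an injection preserves independence of images. -/
theorem aux_mem_map {α β : Type} (f : α → β) (hf : Function.Injective f)
    (m : Multiset (Sym2 α)) (a b : α) :
    s(f a, f b) ∈ m.map (Sym2.map f) ↔ s(a, b) ∈ m := by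
  rw [← Sym2.map_mk]
  exact Multiset.mem_map_of_injective (Sym2.map.injective hf)

theorem aux_iso_le (G₁ G₂ : Multigraph) (e : G₁.V ≃ G₂.V)
    (h : G₂.edges = G₁.edges.map (Sym2.map e)) :
    indepNumber G₁ = indepNumber G₂ := by
  apply le_antisymm
  · obtain ⟨t, ht, hc⟩ := aux_exists G₁
    rw [← hc, ← Finset.card_map e.toEmbedding]
    apply aux_le
    intro a ha b hb
    obtain ⟨a, ha', rfl⟩ := Finset.mem_map.1 ha
    obtain ⟨b, hb', rfl⟩ := Finset.mem_map.1 hb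
    rw [h]
    exact fun hh => ht a ha' b hb' ((aux_mem_map e e.injective _ a b).1 hh)
  · obtain ⟨t, ht, hc⟩ := aux_exists G₂
    rw [← hc, ← Finset.card_map e.symm.toEmbedding]
    apply aux_le
    intro a ha b hb
    obtain ⟨a, ha', rfl⟩ := Finset.mem_map.1 ha
    obtain ⟨b, hb', rfl⟩ := Finset.mem_map.1 hb
    intro hh
    apply ht a ha' b hb'
    rw [h]
    have := (aux_mem_map e e.injective _ _ _).2 hh
    simpa using this

theorem aux_union (G₁ G₂ : Multigraph) (s : Finset G₁.V) (t : Finset G₂.V) :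
    IsIndepSet (G₁.disjUnion G₂) (s.disjSum t) ↔ IsIndepSet G₁ s ∧ IsIndepSet G₂ t := by
  have key : ∀ p, p ∈ (G₁.disjUnion G₂).edges ↔
      p ∈ G₁.edges.map (Sym2.map Sum.inl) ∨ p ∈ G₂.edges.map (Sym2.map Sum.inr) :=
    fun p => Multiset.mem_add
  constructor
  · intro h
    constructor
    · intro a ha b hb hab
      exact h (Sum.inl a) (Finset.inl_mem_disjSum.2 ha) (Sum.inl b) (Finset.inl_mem_disjSum.2 hb)
        ((key _).2 (Or.inl ((aux_mem_map _ Sum.inl_injective _ _ _).2 hab)))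
    · intro a ha b hb hab
      exact h (Sum.inr a) (Finset.inr_mem_disjSum.2 ha) (Sum.inr b) (Finset.inr_mem_disjSum.2 hb)
        ((key _).2 (Or.inr ((aux_mem_map _ Sum.inr_injective _ _ _).2 hab)))
  · rintro ⟨h1, h2⟩ a ha b hb hab
    rcases (key _).1 hab with hm | hm
    · obtain ⟨p, hp, hpe⟩ := Multiset.mem_map.1 hm
      induction p using Sym2.ind with
      | _ x y =>
        rw [Sym2.map_mk] at hpe
        rcases Sym2.eq_iff.1 hpe with ⟨rfl, rfl⟩ | ⟨rfl, rfl⟩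
        · exact h1 x (Finset.inl_mem_disjSum.1 ha) y (Finset.inl_mem_disjSum.1 hb) hp
        · exact h1 x (Finset.inl_mem_disjSum.1 hb) y (Finset.inl_mem_disjSum.1 ha) hp
    · obtain ⟨p, hp, hpe⟩ := Multiset.mem_map.1 hm
      induction p using Sym2.ind with
      | _ x y =>
        rw [Sym2.map_mk] at hpe
        rcases Sym2.eq_iff.1 hpe with ⟨rfl, rfl⟩ | ⟨rfl, rfl⟩
        · exact h2 x (Finset.inr_mem_disjSum.1 ha) y (Finset.inr_mem_disjSum.1 hb) hp
        · exact h2 x (Finset.inr_mem_disjSum.1 hb) y (Finset.inr_mem_disjSum.1 ha) hp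

theorem aux_additive (G₁ G₂ : Multigraph) :
    indepNumber (G₁.disjUnion G₂) = indepNumber G₁ + indepNumber G₂ := by
  apply le_antisymm
  · obtain ⟨u, hu, hc⟩ := aux_exists (G₁.disjUnion G₂)
    change Finset (G₁.V ⊕ G₂.V) at u
    have hs : u.toLeft.disjSum u.toRight = u := Finset.toLeft_disjSum_toRight
    have h := (aux_union G₁ G₂ u.toLeft u.toRight).1 (by rw [hs]; exact hu)
    have h1 := aux_le _ _ h.1
    have h2 := aux_le _ _ h.2
    have h3 : u.toLeft.card + u.toRight.card = u.card := Finset.card_toLeft_add_card_toRight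
    rw [← hc]
    exact h3.symm.le.trans (add_le_add h1 h2)
  · obtain ⟨s, hs, hsc⟩ := aux_exists G₁
    obtain ⟨t, ht, htc⟩ := aux_exists G₂
    rw [← hsc, ← htc, ← Finset.card_disjSum]
    exact aux_le (G₁.disjUnion G₂) (s.disjSum t) ((aux_union G₁ G₂ s t).2 ⟨hs, ht⟩)

theorem aux_concave : GraphParam.Concave indepParam := by
  intro G x _
  have h : ∑ i, ∑ j, (indepParam (G.addEdge i j) - indepParam G) * x i * x j =
      -((∑ i, if i ∈ indepCore G then x i else 0) ^ 2) := by
    rw [sq, Finset.sum_mul_sum, ← Finset.sum_neg_distrib]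
    refine Finset.sum_congr rfl fun i _ => ?_
    rw [← Finset.sum_neg_distrib]
    refine Finset.sum_congr rfl fun j _ => ?_
    rw [aux_inc]
    by_cases hi : i ∈ indepCore G <;> by_cases hj : j ∈ indepCore G <;> simp [hi, hj]
  rw [h]
  exact neg_nonpos.2 (sq_nonneg _)

theorem statement15 :
    GraphParam.Invariant indepParam ∧ GraphParam.Additive indepParam ∧
    GraphParam.Lipschitz indepParam 1 ∧ GraphParam.Concave indepParam ∧
    ∀ (G : Multigraph) (i j : G.V),
      indepParam (G.addEdge i j) =
        indepParam G - (if i ∈ indepCore G ∧ j ∈ indepCore G then 1 else 0) := by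
  refine ⟨fun G₁ G₂ e h => ?_, fun G₁ G₂ => ?_, fun G i j => ?_, aux_concave, aux_inc⟩
  · unfold indepParam
    rw [aux_iso_le G₁ G₂ e h]
  · unfold indepParam
    rw [aux_additive]
    push_cast
    rfl
  · rw [aux_inc]
    split_ifs <;> simp
end

section
/- Fix a finite set S, a map h : S → (0, ∞), and a symmetric map J : S × S → (0, ∞), and define the graph parameter 𝔣(G) := log(Σ_{σ ∈ S^V} Π_{i∈V} h(σ_i) · Π_{ij∈E} J(σ_i, σ_j)) for every finite multigraph G = (V, E) (the product over E counting edges with multiplicity). Then 𝔣 is additive and κ-Lipschitz with κ = max_{s,t∈S} |log J(s,t)|; and if moreover the matrix {J(s,t)}_{(s,t)∈S×S} is conditionally negative semidefinite, then 𝔣 is concave. -/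
open Finset Filter Topology MeasureTheory
open scoped Classical BigOperators ENNReal

theorem aux_psd {ι : Type} [Fintype ι] (K : ι → ι → ℝ) (hs : ∀ i j, K i j = K j i) :
    (Matrix.of K).PosSemidef ↔ ∀ x : ι → ℝ, 0 ≤ ∑ i, ∑ j, K i j * x i * x j := by
  rw [Matrix.posSemidef_iff_dotProduct_mulVec]
  have e : ∀ x : ι → ℝ, star x ⬝ᵥ (Matrix.of K).mulVec x = ∑ i, ∑ j, K i j * x i * x j := by
    intro x
    simp only [dotProduct, Matrix.mulVec, Finset.mul_sum, Matrix.of_apply, Pi.star_apply, star_trivial]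
    refine Finset.sum_congr rfl fun i _ => Finset.sum_congr rfl fun j _ => by ring
  constructor
  · intro h x
    rw [← e]; exact h.2 x
  · intro h
    refine ⟨?_, fun x => ?_⟩
    · ext i j
      simp [Matrix.conjTranspose_apply, hs i j]
    · rw [e]; exact h x

theorem aux_pow {ι : Type} [Fintype ι] (K : ι → ι → ℝ) (hs : ∀ i j, K i j = K j i)
    (hK : ∀ x : ι → ℝ, 0 ≤ ∑ i, ∑ j, K i j * x i * x j) (n : ℕ) :
    (Matrix.of fun i j => K i j ^ n).PosSemidef := by
  induction n with
  | zero =>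
    rw [aux_psd _ (by simp)]
    intro x
    have : ∑ i, ∑ j, K i j ^ 0 * x i * x j = (∑ i, x i) * ∑ i, x i := by
      rw [Finset.sum_mul_sum]; simp
    rw [this]; exact mul_self_nonneg _
  | succ n ih =>
    have := ih.hadamard ((aux_psd K hs).2 hK)
    have e : (Matrix.of fun i j => K i j ^ (n + 1))
        = (Matrix.of fun i j => K i j ^ n).hadamard (Matrix.of K) := by
      ext i j; simp [pow_succ]
    rw [e]; exact this

theorem aux_exp {ι : Type} [Fintype ι] (K : ι → ι → ℝ) (hs : ∀ i j, K i j = K j i)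
    (hK : ∀ x : ι → ℝ, 0 ≤ ∑ i, ∑ j, K i j * x i * x j) (x : ι → ℝ) :
    0 ≤ ∑ i, ∑ j, Real.exp (K i j) * x i * x j := by
  have h1 : HasSum (fun n : ℕ => ∑ i, ∑ j, K i j ^ n / (n.factorial : ℝ) * x i * x j)
      (∑ i, ∑ j, Real.exp (K i j) * x i * x j) := by
    refine hasSum_sum fun i _ => hasSum_sum fun j _ => ?_
    have := NormedSpace.expSeries_div_hasSum_exp (K i j)
    rw [← Real.exp_eq_exp_ℝ] at this
    exact (this.mul_right _).mul_right _
  refine h1.nonneg fun n => ?_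
  have := (aux_psd _ (fun i j => by rw [hs i j])).1 (aux_pow K hs hK n) x
  have e : ∑ i, ∑ j, K i j ^ n / (n.factorial : ℝ) * x i * x j
      = (∑ i, ∑ j, K i j ^ n * x i * x j) / (n.factorial : ℝ) := by
    simp only [Finset.sum_div]
    refine Finset.sum_congr rfl fun i _ => Finset.sum_congr rfl fun j _ => by ring
  rw [e]; positivity

theorem aux_schoenberg {ι : Type} [Fintype ι] (N : ι → ι → ℝ) (hs : ∀ i j, N i j = N j i)
    (hN : ∀ x : ι → ℝ, ∑ i, x i = 0 → ∑ i, ∑ j, N i j * x i * x j ≤ 0) (x : ι → ℝ) :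
    0 ≤ ∑ i, ∑ j, Real.exp (-N i j) * x i * x j := by
  rcases isEmpty_or_nonempty ι with he | ⟨⟨o⟩⟩
  · simp
  have key := aux_exp (fun i j => N i o + N j o - N i j - N o o)
    (fun i j => by rw [hs i j]; ring) ?_
    (fun i => Real.exp (-N i o + N o o / 2) * x i)
  · refine key.trans_eq (Finset.sum_congr rfl fun i _ => Finset.sum_congr rfl fun j _ => ?_)
    have e : Real.exp (-N i j) = Real.exp (N i o + N j o - N i j - N o o)
        * Real.exp (-N i o + N o o / 2) * Real.exp (-N j o + N o o / 2) := by
      rw [← Real.exp_add, ← Real.exp_add]; congr 1; ring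
    rw [e]; ring
  · intro y
    set c := ∑ i, y i with hc
    have h := hN (fun i => y i - if i = o then c else 0) (by simp [hc])
    have e : ∑ i, ∑ j, N i j * (y i - if i = o then c else 0) * (y j - if j = o then c else 0)
      = -∑ i, ∑ j, (N i o + N j o - N i j - N o o) * y i * y j := by
      have e1 : ∑ i, ∑ j, N i j * (y i - if i = o then c else 0) * (y j - if j = o then c else 0)
        = ∑ i, ∑ j, N i j * y i * y j - c * ∑ i, N i o * y i - c * ∑ j, N j o * y j + N o o * c * c := by
        simp only [mul_sub, sub_mul, Finset.sum_sub_distrib, mul_ite, ite_mul, mul_zero, zero_mul,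
          Finset.sum_ite_eq', Finset.mem_univ, if_true, Finset.mul_sum]
        rw [Finset.sum_comm (f := fun i j => if i = o then _ else _)]
        simp only [Finset.sum_ite_eq', Finset.mem_univ, if_true]
        have : ∀ j, N o j = N j o := fun j => hs o j
        simp only [this, mul_comm, mul_left_comm]
        ring
      have e2 : ∑ i, ∑ j, (N i o + N j o - N i j - N o o) * y i * y j
        = (∑ i, N i o * y i) * c + c * (∑ j, N j o * y j) - ∑ i, ∑ j, N i j * y i * y j
          - N o o * (c * c) := by
        rw [hc, Finset.sum_mul_sum, Finset.sum_mul_sum, Finset.sum_mul_sum]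
        simp only [Finset.mul_sum, ← Finset.sum_sub_distrib, ← Finset.sum_add_distrib]
        refine Finset.sum_congr rfl fun i _ => Finset.sum_congr rfl fun j _ => by ring
      rw [e1, e2]; ring
    rw [e] at h
    linarith

theorem aux_mono (F F' : ℝ → ℝ) (hF : ∀ t, 0 ≤ t → HasDerivAt F (F' t) t)
    (h0 : ∀ t, 0 ≤ t → 0 ≤ F' t) (hl : Tendsto F atTop (𝓝 0)) : F 0 ≤ 0 := by
  have hm : MonotoneOn F (Set.Ici 0) := by
    refine monotoneOn_of_deriv_nonneg (convex_Ici 0)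
      (fun t ht => (hF t ht).continuousAt.continuousWithinAt)
      (fun t ht => ((hF t (interior_subset ht)).differentiableAt).differentiableWithinAt) ?_
    intro t ht
    rw [(hF t (interior_subset ht)).deriv]
    exact h0 t (interior_subset ht)
  refine ge_of_tendsto hl ?_
  filter_upwards [eventually_ge_atTop (0 : ℝ)] with t ht
  exact hm (Set.self_mem_Ici) ht ht

theorem aux_inv {ι : Type} [Fintype ι] (N : ι → ι → ℝ) (hs : ∀ i j, N i j = N j i)
    (hp : ∀ i j, 0 < N i j)
    (hN : ∀ x : ι → ℝ, ∑ i, x i = 0 → ∑ i, ∑ j, N i j * x i * x j ≤ 0) (x : ι → ℝ) :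
    0 ≤ ∑ i, ∑ j, (N i j)⁻¹ * x i * x j := by
  have := aux_mono (fun t => ∑ i, ∑ j, (-(N i j)⁻¹ * Real.exp (-(t * N i j))) * x i * x j)
    (fun t => ∑ i, ∑ j, Real.exp (-(t * N i j)) * x i * x j) ?_ ?_ ?_
  · simpa using this
  · intro t ht
    refine HasDerivAt.fun_sum fun i _ => HasDerivAt.fun_sum fun j _ => ?_
    refine HasDerivAt.mul_const (HasDerivAt.mul_const ?_ _) _
    have h1 : HasDerivAt (fun t : ℝ => -(t * N i j)) (-(1 * N i j)) t :=
      ((hasDerivAt_id t).mul_const _).neg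
    convert (h1.exp.const_mul (-(N i j)⁻¹)) using 1
    have := (hp i j).ne'
    field_simp
  · intro t ht
    refine aux_schoenberg (fun i j => t * N i j) (fun i j => by rw [hs i j]) ?_ x
    intro y hy
    have e : ∑ i, ∑ j, t * N i j * y i * y j = t * ∑ i, ∑ j, N i j * y i * y j := by
      simp only [Finset.mul_sum, mul_assoc]
    rw [e]
    exact mul_nonpos_of_nonneg_of_nonpos ht (hN y hy)
  · rw [show (0 : ℝ) = ∑ i : ι, ∑ j : ι, (-(N i j)⁻¹ * 0) * x i * x j by simp]
    refine tendsto_finsetSum _ fun i _ => tendsto_finsetSum _ fun j _ => ?_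
    refine (Tendsto.mul_const _ (Tendsto.mul_const _ (Tendsto.const_mul _ ?_)))
    exact Real.tendsto_exp_neg_atTop_nhds_zero.comp (tendsto_id.atTop_mul_const (hp i j))

theorem aux_log {ι : Type} [Fintype ι] (N : ι → ι → ℝ) (hs : ∀ i j, N i j = N j i)
    (hp : ∀ i j, 0 < N i j)
    (hN : ∀ x : ι → ℝ, ∑ i, x i = 0 → ∑ i, ∑ j, N i j * x i * x j ≤ 0) (x : ι → ℝ)
    (hx : ∑ i, x i = 0) :
    ∑ i, ∑ j, Real.log (N i j) * x i * x j ≤ 0 := by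
  have hc : ∀ (c : ℝ) (y : ι → ℝ), ∑ i, y i = 0 → ∑ i, ∑ j, c * y i * y j = 0 := by
    intro c y hy
    simp only [← Finset.mul_sum, hy, mul_zero, Finset.sum_const_zero]
  have := aux_mono (fun t => ∑ i, ∑ j, Real.log (t + N i j) * x i * x j)
    (fun t => ∑ i, ∑ j, (t + N i j)⁻¹ * x i * x j) ?_ ?_ ?_
  · simpa using this
  · intro t ht
    refine HasDerivAt.fun_sum fun i _ => HasDerivAt.fun_sum fun j _ => ?_
    refine HasDerivAt.mul_const (HasDerivAt.mul_const ?_ _) _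
    have h1 : HasDerivAt (fun t : ℝ => t + N i j) 1 t := (hasDerivAt_id t).add_const _
    have := h1.log (by have := hp i j; positivity)
    simpa using this
  · intro t ht
    refine aux_inv (fun i j => t + N i j) (fun i j => by rw [hs i j])
      (fun i j => by have := hp i j; positivity) ?_ x
    intro y hy
    simp only [add_mul, Finset.sum_add_distrib, hc t y hy, zero_add]
    exact hN y hy
  · have e : (fun t => ∑ i, ∑ j, Real.log (t + N i j) * x i * x j)
        = fun t => ∑ i, ∑ j, (Real.log (t + N i j) - Real.log t) * x i * x j := by
      funext t
      simp only [sub_mul, Finset.sum_sub_distrib, hc (Real.log t) x hx, sub_zero]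
    rw [e, show (0 : ℝ) = ∑ i : ι, ∑ j : ι, 0 * x i * x j by simp]
    refine tendsto_finsetSum _ fun i _ => tendsto_finsetSum _ fun j _ => ?_
    exact Tendsto.mul_const _ (Tendsto.mul_const _ (Real.tendsto_log_comp_add_sub_log _))

theorem statement17 (S : Type) [Fintype S] [Nonempty S]
    (h : S → ℝ) (J : S → S → ℝ)
    (hh : ∀ s, 0 < h s) (hJpos : ∀ s t, 0 < J s t)
    (hJsym : ∀ s t, J s t = J t s)
    (f : Multigraph → ℝ)
    (hf : ∀ G : Multigraph,
      f G = Real.log (∑ σ : G.V → S,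
        (∏ i, h (σ i)) *
          (G.edges.map (Sym2.lift
            ⟨fun i j => J (σ i) (σ j), fun a b => hJsym (σ a) (σ b)⟩)).prod)) :
    GraphParam.Invariant f ∧ GraphParam.Additive f ∧
    GraphParam.Lipschitz f
      (Finset.univ.sup' Finset.univ_nonempty fun p : S × S => |Real.log (J p.1 p.2)|) ∧
    ((∀ x : S → ℝ, (∑ s, x s) = 0 → ∑ s, ∑ t, J s t * x s * x t ≤ 0) →
      GraphParam.Concave f) := by
  set w : (G : Multigraph) → (G.V → S) → ℝ := fun G σ =>
    (∏ i, h (σ i)) * (G.edges.map (Sym2.lift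
            ⟨fun i j => J (σ i) (σ j), fun a b => hJsym (σ a) (σ b)⟩)).prod with hw
  have hwpos : ∀ G σ, 0 < w G σ := by
    intro G σ
    refine mul_pos (Finset.prod_pos fun i _ => hh _) ?_
    refine Multiset.prod_induction (fun r : ℝ => 0 < r) _ (fun a b => mul_pos) one_pos ?_
    intro a ha
    obtain ⟨e, -, rfl⟩ := Multiset.mem_map.1 ha
    induction e using Sym2.ind with
    | _ a b => exact hJpos _ _
  have hZpos : ∀ G, 0 < ∑ σ, w G σ := fun G =>
    Finset.sum_pos (fun σ _ => hwpos G σ) Finset.univ_nonempty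
  have hfw : ∀ G, f G = Real.log (∑ σ, w G σ) := hf
  have hadd : ∀ (G : Multigraph) (i j : G.V),
      f (G.addEdge i j) = Real.log (∑ σ : G.V → S, J (σ i) (σ j) * w G σ) := by
    intro G i j
    rw [hfw]
    change Real.log (∑ σ : G.V → S, w (G.addEdge i j) σ) = _
    congr 1
    refine Finset.sum_congr rfl fun σ _ => ?_
    simp only [hw, Multigraph.addEdge, Multiset.map_cons, Multiset.prod_cons, Sym2.lift_mk]
    ring
  clear_value w
  refine ⟨?_, ?_, ?_, ?_⟩
  · intro G₁ G₂ e he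
    rw [hfw, hfw]
    congr 1
    refine Fintype.sum_equiv (e.arrowCongr (Equiv.refl S)) _ _ fun σ => ?_
    rw [hw]
    simp only [he, Multiset.map_map]
    congr 1
    · exact Fintype.prod_equiv e _ _ (by simp)
    · congr 1
      refine Multiset.map_congr rfl fun a _ => ?_
      induction a using Sym2.ind with
      | _ a b => simp
  · intro G₁ G₂
    rw [hfw, hfw, hfw, ← Real.log_mul (hZpos _).ne' (hZpos _).ne']
    congr 1
    rw [Finset.sum_mul_sum, ← Finset.sum_product', Finset.univ_product_univ]
    let e : ((G₁.disjUnion G₂).V → S) ≃ (G₁.V → S) × (G₂.V → S) :=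
      Equiv.sumArrowEquivProdArrow G₁.V G₂.V S
    refine Fintype.sum_equiv e (fun σ => w (G₁.disjUnion G₂) σ)
      (fun p => w G₁ p.1 * w G₂ p.2) fun σ => ?_
    rw [hw]
    simp only [Multigraph.disjUnion, Multiset.map_add, Multiset.prod_add, Multiset.map_map]
    rw [mul_mul_mul_comm]
    congr 1
    · exact Fintype.prod_sum_type _
    · congr 1
      · congr 1
        refine Multiset.map_congr rfl fun a _ => ?_
        induction a using Sym2.ind with
        | _ a b => rfl
      · congr 1
        refine Multiset.map_congr rfl fun a _ => ?_
        induction a using Sym2.ind with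
        | _ a b => rfl
  · intro G i j
    set κ := Finset.univ.sup' Finset.univ_nonempty fun p : S × S => |Real.log (J p.1 p.2)| with hκ
    have hb : ∀ s t, |Real.log (J s t)| ≤ κ := fun s t =>
      Finset.le_sup' (fun p : S × S => |Real.log (J p.1 p.2)|) (Finset.mem_univ (s, t))
    have hu : ∀ s t, J s t ≤ Real.exp κ := fun s t =>
      (Real.log_le_iff_le_exp (hJpos s t)).1 (abs_le.1 (hb s t)).2
    have hl : ∀ s t, Real.exp (-κ) ≤ J s t := fun s t =>
      (Real.le_log_iff_exp_le (hJpos s t)).1 (abs_le.1 (hb s t)).1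
    have hpos : 0 < ∑ σ : G.V → S, J (σ i) (σ j) * w G σ :=
      Finset.sum_pos (fun σ _ => mul_pos (hJpos _ _) (hwpos G σ)) Finset.univ_nonempty
    rw [hadd, hfw, ← Real.log_div hpos.ne' (hZpos G).ne', abs_le]
    have hq := div_pos hpos (hZpos G)
    constructor
    · rw [Real.le_log_iff_exp_le hq, le_div_iff₀ (hZpos G), Finset.mul_sum]
      exact Finset.sum_le_sum fun σ _ => mul_le_mul_of_nonneg_right (hl _ _) (hwpos G σ).le
    · rw [Real.log_le_iff_le_exp hq, div_le_iff₀ (hZpos G), Finset.mul_sum]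
      exact Finset.sum_le_sum fun σ _ => mul_le_mul_of_nonneg_right (hu _ _) (hwpos G σ).le
  · intro hJ G x hx
    have hpos : ∀ i j, 0 < ∑ σ : G.V → S, J (σ i) (σ j) * w G σ := fun i j =>
      Finset.sum_pos (fun σ _ => mul_pos (hJpos _ _) (hwpos G σ)) Finset.univ_nonempty
    have key := aux_log (fun i j => ∑ σ : G.V → S, J (σ i) (σ j) * w G σ)
      (fun i j => Finset.sum_congr rfl fun σ _ => by rw [hJsym]) hpos ?_ x hx
    · simp only [hadd, sub_mul, Finset.sum_sub_distrib]
      have : ∑ i, ∑ j, f G * x i * x j = 0 := by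
        simp only [← Finset.mul_sum, hx, mul_zero, Finset.sum_const_zero]
      rw [this, sub_zero]
      exact key
    · intro y hy
      have e : ∑ i, ∑ j, (∑ σ : G.V → S, J (σ i) (σ j) * w G σ) * y i * y j
          = ∑ σ : G.V → S, w G σ * ∑ i, ∑ j, J (σ i) (σ j) * y i * y j := by
        simp only [Finset.sum_mul, Finset.mul_sum]
        rw [Finset.sum_comm (s := (Finset.univ : Finset (G.V → S)))]
        refine Finset.sum_congr rfl fun i _ => ?_
        rw [Finset.sum_comm (s := (Finset.univ : Finset (G.V → S)))]
        refine Finset.sum_congr rfl fun j _ => Finset.sum_congr rfl fun σ _ => by ring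
      rw [e]
      refine Finset.sum_nonpos fun σ _ => mul_nonpos_of_nonneg_of_nonpos (hwpos G σ).le ?_
      have h2 := hJ (fun s => ∑ i, if σ i = s then y i else 0) (by
        rw [Finset.sum_comm]; simpa using hy)
      have e2 : ∑ i, ∑ j, J (σ i) (σ j) * y i * y j
          = ∑ s, ∑ t, J s t * (∑ i, if σ i = s then y i else 0)
            * (∑ i, if σ i = t then y i else 0) := by
        have a1 : ∀ (c : S → ℝ), ∑ s, c s * (∑ i, if σ i = s then y i else 0)
            = ∑ i, c (σ i) * y i := by
          intro c
          simp only [Finset.mul_sum]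
          rw [Finset.sum_comm]
          simp
        simp only [a1]
        rw [Finset.sum_comm]
        conv_rhs => rw [Finset.sum_comm]
        refine Finset.sum_congr rfl fun j _ => ?_
        rw [← Finset.sum_mul, ← Finset.sum_mul, a1 fun s => J s (σ j)]
      rw [e2]
      exact h2
end

section
/- For every inverse temperature β ≥ 0, the log-partition function of the antiferromagnetic Ising model, 𝔣(G) := log(Σ_{σ ∈ {−1,+1}^V} Π_{ij∈E} e^{−β σ_i σ_j}) for finite multigraphs G = (V, E), is an additive, β-Lipschitz, concave graph parameter; in particular the 2×2 matrix {e^{−β s t}}_{s,t ∈ {−1,+1}} is conditionally negative semidefinite for all β ≥ 0. -/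
open Finset Filter Topology MeasureTheory
open scoped Classical BigOperators ENNReal

/-- The spin `±1` associated with a Boolean. -/
noncomputable def spin : Bool → ℝ := fun b => if b then 1 else -1

noncomputable def isingW (β : ℝ) {V : Type} (E : Multiset (Sym2 V)) (σ : V → Bool) : ℝ :=
  (E.map (Sym2.lift
          ⟨fun i j => Real.exp (-β * spin (σ i) * spin (σ j)),
            fun a b => congrArg Real.exp (mul_right_comm (-β) (spin (σ a)) (spin (σ b)))⟩)).prod

theorem isingW_pos (β : ℝ) {V : Type} (E : Multiset (Sym2 V)) (σ : V → Bool) :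
    0 < isingW β E σ := by
  unfold isingW
  apply Multiset.prod_pos
  intro a ha
  obtain ⟨e, -, rfl⟩ := Multiset.mem_map.1 ha
  induction e with
  | _ i j => exact Real.exp_pos _

theorem isingW_cons (β : ℝ) {V : Type} (E : Multiset (Sym2 V)) (σ : V → Bool) (i j : V) :
    isingW β (s(i, j) ::ₘ E) σ = Real.exp (-β * spin (σ i) * spin (σ j)) * isingW β E σ := by
  simp [isingW]

theorem isingW_map (β : ℝ) {V U : Type} (E : Multiset (Sym2 V)) (g : V → U) (σ : U → Bool) :
    isingW β (E.map (Sym2.map g)) σ = isingW β E (σ ∘ g) := by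
  unfold isingW
  rw [Multiset.map_map]
  congr 1
  apply Multiset.map_congr rfl
  intro e _
  induction e with
  | _ i j => rfl

theorem isingW_add (β : ℝ) {V : Type} (E F : Multiset (Sym2 V)) (σ : V → Bool) :
    isingW β (E + F) σ = isingW β E σ * isingW β F σ := by
  simp [isingW]

noncomputable def isingZ (β : ℝ) (G : Multigraph) : ℝ := ∑ σ : G.V → Bool, isingW β G.edges σ

theorem isingZ_pos (β : ℝ) (G : Multigraph) : 0 < isingZ β G :=
  Finset.sum_pos (fun σ _ => isingW_pos β _ σ) ⟨fun _ => true, Finset.mem_univ _⟩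

theorem isingZ_addEdge (β : ℝ) (G : Multigraph) (i j : G.V) :
    isingZ β (G.addEdge i j) =
      ∑ σ : G.V → Bool, Real.exp (-β * spin (σ i) * spin (σ j)) * isingW β G.edges σ :=
  Finset.sum_congr rfl fun σ _ => isingW_cons β _ σ i j

theorem spin_exp (β : ℝ) (a b : Bool) :
    Real.exp (-β * spin a * spin b) = Real.cosh β - Real.sinh β * (spin a * spin b) := by
  have h1 := Real.cosh_sub_sinh β
  have h2 := Real.cosh_add_sinh β
  cases a <;> cases b <;> simp [spin] <;> linarith

theorem spin_mul_abs (a b : Bool) : |spin a * spin b| = 1 := by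
  cases a <;> cases b <;> simp [spin]

noncomputable def isingC (β : ℝ) (G : Multigraph) (i j : G.V) : ℝ :=
  ∑ σ : G.V → Bool, isingW β G.edges σ / isingZ β G * (spin (σ i) * spin (σ j))

theorem isingP_sum (β : ℝ) (G : Multigraph) :
    ∑ σ : G.V → Bool, isingW β G.edges σ / isingZ β G = 1 := by
  rw [← Finset.sum_div]
  exact div_self (isingZ_pos β G).ne'

theorem isingC_abs (β : ℝ) (G : Multigraph) (i j : G.V) : |isingC β G i j| ≤ 1 := by
  unfold isingC
  refine (Finset.abs_sum_le_sum_abs _ _).trans ?_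
  rw [← isingP_sum β G]
  apply Finset.sum_le_sum
  intro σ _
  rw [abs_mul, spin_mul_abs, mul_one,
    abs_of_pos (div_pos (isingW_pos _ _ _) (isingZ_pos _ _))]

theorem isingZ_ratio (β : ℝ) (G : Multigraph) (i j : G.V) :
    isingZ β (G.addEdge i j) =
      isingZ β G * (Real.cosh β * (1 - Real.tanh β * isingC β G i j)) := by
  have hc := (Real.cosh_pos β).ne'
  have hz := (isingZ_pos β G).ne'
  have h : Real.cosh β * (1 - Real.tanh β * isingC β G i j)
      = Real.cosh β - Real.sinh β * isingC β G i j := by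
    rw [Real.tanh_eq_sinh_div_cosh]; field_simp
  rw [h, isingZ_addEdge]
  simp only [spin_exp, sub_mul, Finset.sum_sub_distrib]
  rw [← Finset.mul_sum, mul_sub]
  congr 1
  · unfold isingZ; ring
  · unfold isingC
    rw [Finset.mul_sum, Finset.mul_sum]
    apply Finset.sum_congr rfl
    intro σ _
    field_simp

theorem isingC_pow_psd (β : ℝ) (G : Multigraph) (n : ℕ) : ∀ x : G.V → ℝ,
    0 ≤ ∑ i, ∑ j, isingC β G i j ^ n * (x i * x j) := by
  induction n with
  | zero =>
    intro x
    simp only [pow_zero, one_mul]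
    rw [← Finset.sum_mul_sum]
    exact mul_self_nonneg _
  | succ n ih =>
    intro x
    have h : ∑ i, ∑ j, isingC β G i j ^ (n + 1) * (x i * x j) =
        ∑ σ : G.V → Bool, isingW β G.edges σ / isingZ β G *
          ∑ i, ∑ j, isingC β G i j ^ n * ((spin (σ i) * x i) * (spin (σ j) * x j)) := by
      simp only [Finset.mul_sum]
      rw [Finset.sum_comm' (t' := Finset.univ) (s' := fun _ => Finset.univ) (by simp)]
      rw [Finset.sum_comm]
      rw [Finset.sum_comm]
      conv_rhs => rw [Finset.sum_comm]
      rw [Finset.sum_comm]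
      apply Finset.sum_congr rfl
      intro i _
      conv_rhs => rw [Finset.sum_comm]
      apply Finset.sum_congr rfl
      intro j _
      rw [pow_succ]
      conv_lhs => rw [show isingC β G i j ^ n * isingC β G i j * (x i * x j) =
        isingC β G i j * (isingC β G i j ^ n * (x i * x j)) by ring]
      conv_lhs => arg 1; unfold isingC
      rw [Finset.sum_mul]
      apply Finset.sum_congr rfl
      intro σ _
      ring
    rw [h]
    apply Finset.sum_nonneg
    intro σ _
    exact mul_nonneg (div_pos (isingW_pos _ _ _) (isingZ_pos _ _)).le (ih _)

theorem ising_log_psd (β : ℝ) (hβ : 0 ≤ β) (G : Multigraph) (x : G.V → ℝ) :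
    ∑ i, ∑ j, Real.log (1 - Real.tanh β * isingC β G i j) * (x i * x j) ≤ 0 := by
  have ht0 : 0 ≤ Real.tanh β := by
    rw [Real.tanh_eq_sinh_div_cosh]
    exact div_nonneg (Real.sinh_nonneg_iff.2 hβ) (Real.cosh_pos β).le
  have hs : ∀ i j : G.V, HasSum (fun n : ℕ =>
      (Real.tanh β * isingC β G i j) ^ (n + 1) / ((n : ℝ) + 1) * (x i * x j))
      (-Real.log (1 - Real.tanh β * isingC β G i j) * (x i * x j)) := by
    intro i j
    apply HasSum.mul_right
    apply Real.hasSum_pow_div_log_of_abs_lt_one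
    rw [abs_mul]
    calc _ ≤ |Real.tanh β| * 1 := by gcongr; exact isingC_abs β G i j
      _ < 1 := by rw [mul_one]; exact Real.abs_tanh_lt_one β
  have hs2 := hasSum_sum (s := Finset.univ) fun i _ =>
    hasSum_sum (s := Finset.univ) fun j _ => hs i j
  have h := hs2.nonneg (fun n => by
    have e : ∑ i, ∑ j, (Real.tanh β * isingC β G i j) ^ (n + 1) / ((n : ℝ) + 1) * (x i * x j)
      = Real.tanh β ^ (n + 1) / ((n : ℝ) + 1) *
        ∑ i, ∑ j, isingC β G i j ^ (n + 1) * (x i * x j) := by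
      simp only [Finset.mul_sum]
      refine Finset.sum_congr rfl fun i _ => Finset.sum_congr rfl fun j _ => ?_
      rw [mul_pow]; ring
    show 0 ≤ ∑ i, ∑ j, (Real.tanh β * isingC β G i j) ^ (n + 1) / ((n : ℝ) + 1) * (x i * x j)
    rw [e]
    exact mul_nonneg (by positivity) (isingC_pow_psd β G _ x))
  simp only [neg_mul, Finset.sum_neg_distrib] at h
  linarith

theorem statement18 (β : ℝ) (hβ : 0 ≤ β) (f : Multigraph → ℝ)
    (hf : ∀ G : Multigraph,
      f G = Real.log (∑ σ : G.V → Bool,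
        (G.edges.map (Sym2.lift
          ⟨fun i j => Real.exp (-β * spin (σ i) * spin (σ j)),
            fun a b => congrArg Real.exp (mul_right_comm (-β) (spin (σ a)) (spin (σ b)))⟩)).prod)) :
    GraphParam.Invariant f ∧ GraphParam.Additive f ∧
    GraphParam.Lipschitz f β ∧ GraphParam.Concave f ∧
    ∀ x : Bool → ℝ, (∑ s, x s) = 0 →
      ∑ s : Bool, ∑ t : Bool, Real.exp (-β * spin s * spin t) * x s * x t ≤ 0 := by
  have hf' : ∀ G, f G = Real.log (isingZ β G) := hf
  have hexp : ∀ a b : Bool, Real.exp (-β) ≤ Real.exp (-β * spin a * spin b) ∧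
      Real.exp (-β * spin a * spin b) ≤ Real.exp β := by
    intro a b
    cases a <;> cases b <;> simp [spin] <;> linarith
  refine ⟨?_, ?_, ?_, ?_, ?_⟩
  · intro G₁ G₂ e he
    rw [hf', hf']
    congr 1
    unfold isingZ
    rw [he]
    symm
    apply Fintype.sum_equiv (Equiv.arrowCongr e.symm (Equiv.refl Bool))
    intro σ
    rw [isingW_map]
    rfl
  · intro G₁ G₂
    rw [hf', hf', hf', ← Real.log_mul (isingZ_pos _ _).ne' (isingZ_pos _ _).ne']
    congr 1
    unfold isingZ
    rw [Finset.sum_mul_sum, ← Finset.sum_product', Finset.univ_product_univ]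
    let e : ((G₁.disjUnion G₂).V → Bool) ≃ (G₁.V → Bool) × (G₂.V → Bool) :=
      Equiv.sumArrowEquivProdArrow G₁.V G₂.V Bool
    apply Fintype.sum_equiv e
    intro σ
    have h : ∀ τ : G₁.V ⊕ G₂.V → Bool,
        isingW β (G₁.edges.map (Sym2.map Sum.inl) + G₂.edges.map (Sym2.map Sum.inr)) τ =
          isingW β G₁.edges (τ ∘ Sum.inl) * isingW β G₂.edges (τ ∘ Sum.inr) := by
      intro τ
      rw [isingW_add, isingW_map, isingW_map]
    exact h σ
  · intro G i j
    rw [hf', hf', ← Real.log_div (isingZ_pos _ _).ne' (isingZ_pos _ _).ne', abs_le]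
    have hp := isingZ_pos β G
    have hq := isingZ_pos β (G.addEdge i j)
    constructor
    · rw [Real.le_log_iff_exp_le (div_pos hq hp), le_div_iff₀ hp, isingZ_addEdge, isingZ,
        Finset.mul_sum]
      exact Finset.sum_le_sum fun σ _ =>
        mul_le_mul_of_nonneg_right (hexp _ _).1 (isingW_pos _ _ _).le
    · rw [Real.log_le_iff_le_exp (div_pos hq hp), div_le_iff₀ hp, isingZ_addEdge, isingZ,
        Finset.mul_sum]
      exact Finset.sum_le_sum fun σ _ =>
        mul_le_mul_of_nonneg_right (hexp _ _).2 (isingW_pos _ _ _).le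
  · intro G x hx
    have key : ∀ i j : G.V, (f (G.addEdge i j) - f G) * x i * x j =
        Real.log (Real.cosh β) * (x i * x j) +
          Real.log (1 - Real.tanh β * isingC β G i j) * (x i * x j) := by
      intro i j
      have hp := isingZ_pos β G
      have hq := isingZ_pos β (G.addEdge i j)
      have hr := isingZ_ratio β G i j
      have h1 : Real.cosh β * (1 - Real.tanh β * isingC β G i j) ≠ 0 := by
        intro h0
        rw [h0, mul_zero] at hr
        exact hq.ne' hr
      rw [hf', hf', hr, Real.log_mul hp.ne' h1,
        Real.log_mul (left_ne_zero_of_mul h1) (right_ne_zero_of_mul h1)]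
      ring
    simp only [key, Finset.sum_add_distrib]
    have h0 : ∑ i, ∑ j, Real.log (Real.cosh β) * (x i * x j) = 0 := by
      simp only [← Finset.mul_sum, hx, mul_zero, Finset.sum_const_zero]
    rw [h0, zero_add]
    exact ising_log_psd β hβ G x
  · intro x hx
    simp only [Fintype.sum_bool] at hx ⊢
    have hx' : x true = - x false := by linarith
    rw [hx']
    have : Real.exp (-β) ≤ Real.exp β := Real.exp_le_exp.2 (by linarith)
    simp only [spin]
    norm_num
    nlinarith [mul_self_nonneg (x false)]
end

section
/- For every integer q ≥ 2 and every inverse temperature β ≥ 0, the log-partition function of the antiferromagnetic q-state Potts model, 𝔣(G) := log(Σ_{σ ∈ {1,…,q}^V} Π_{ij∈E} (𝟙_{σ_i ≠ σ_j} + e^{−β} 𝟙_{σ_i = σ_j})) for finite multigraphs G = (V, E), is an additive, β-Lipschitz, concave graph parameter; in particular the q×q matrix {𝟙_{s≠t} + e^{−β} 𝟙_{s=t}}_{s,t ∈ {1,…,q}} is conditionally negative semidefinite for all β ≥ 0. -/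
open Finset Filter Topology MeasureTheory
open scoped Classical BigOperators ENNReal

/-- Boltzmann weight of an edge. -/
noncomputable def pottsEdge (q : ℕ) (β : ℝ) {V : Type} (σ : V → Fin q) : Sym2 V → ℝ :=
  Sym2.lift
    ⟨fun i j => if σ i = σ j then Real.exp (-β) else 1,
      fun a b => if_congr eq_comm rfl rfl⟩

/-- Boltzmann weight of a configuration. -/
noncomputable def pottsW (q : ℕ) (β : ℝ) {V : Type} (E : Multiset (Sym2 V)) (σ : V → Fin q) : ℝ :=
  (E.map (pottsEdge q β σ)).prod

/-- Partition function. -/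
noncomputable def pottsZ (q : ℕ) (β : ℝ) (G : Multigraph) : ℝ :=
  ∑ σ : G.V → Fin q, pottsW q β G.edges σ

lemma pottsEdge_mk (q : ℕ) (β : ℝ) {V : Type} (σ : V → Fin q) (i j : V) :
    pottsEdge q β σ s(i, j) = if σ i = σ j then Real.exp (-β) else 1 := rfl

lemma pottsEdge_pos (q : ℕ) (β : ℝ) {V : Type} (σ : V → Fin q) (e : Sym2 V) :
    0 < pottsEdge q β σ e := by
  induction e using Sym2.ind with
  | _ i j =>
    rw [pottsEdge_mk]
    split_ifs
    · exact Real.exp_pos _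
    · exact one_pos

lemma pottsEdge_map (q : ℕ) (β : ℝ) {V W : Type} (g : V → W) (σ : W → Fin q) (e : Sym2 V) :
    pottsEdge q β σ (Sym2.map g e) = pottsEdge q β (σ ∘ g) e := by
  induction e using Sym2.ind with
  | _ i j => rfl

lemma pottsW_pos (q : ℕ) (β : ℝ) {V : Type} (E : Multiset (Sym2 V)) (σ : V → Fin q) :
    0 < pottsW q β E σ := by
  unfold pottsW
  induction E using Multiset.induction_on with
  | empty => simp
  | cons a s ih =>
    rw [Multiset.map_cons, Multiset.prod_cons]
    exact mul_pos (pottsEdge_pos q β σ a) ih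

lemma pottsW_map (q : ℕ) (β : ℝ) {V W : Type} (g : V → W) (E : Multiset (Sym2 V))
    (σ : W → Fin q) :
    pottsW q β (E.map (Sym2.map g)) σ = pottsW q β E (σ ∘ g) := by
  unfold pottsW
  rw [Multiset.map_map]
  congr 1
  apply Multiset.map_congr rfl
  intro e _
  exact pottsEdge_map q β g σ e

lemma pottsW_add (q : ℕ) (β : ℝ) {V : Type} (E F : Multiset (Sym2 V)) (σ : V → Fin q) :
    pottsW q β (E + F) σ = pottsW q β E σ * pottsW q β F σ := by
  simp [pottsW]

lemma pottsW_cons (q : ℕ) (β : ℝ) {V : Type} (E : Multiset (Sym2 V)) (i j : V) (σ : V → Fin q) :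
    pottsW q β (s(i, j) ::ₘ E) σ
      = (if σ i = σ j then Real.exp (-β) else 1) * pottsW q β E σ := by
  unfold pottsW
  rw [Multiset.map_cons, Multiset.prod_cons, pottsEdge_mk]

lemma pottsZ_pos (q : ℕ) (hq : 2 ≤ q) (β : ℝ) (G : Multigraph) : 0 < pottsZ q β G := by
  have : Nonempty (Fin q) := ⟨⟨0, by omega⟩⟩
  exact Finset.sum_pos (fun σ _ => pottsW_pos q β G.edges σ) Finset.univ_nonempty

/-- Unnormalised collision probability. -/
noncomputable def pottsA (q : ℕ) (β : ℝ) (G : Multigraph) (i j : G.V) : ℝ :=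
  ∑ σ : G.V → Fin q, pottsW q β G.edges σ * (if σ i = σ j then 1 else 0)

lemma pottsZ_addEdge (q : ℕ) (β : ℝ) (G : Multigraph) (i j : G.V) :
    pottsZ q β (G.addEdge i j) = pottsZ q β G - (1 - Real.exp (-β)) * pottsA q β G i j := by
  unfold pottsZ pottsA
  rw [Finset.mul_sum, ← Finset.sum_sub_distrib]
  apply Finset.sum_congr rfl
  intro σ _
  have : pottsW q β (G.addEdge i j).edges σ
      = (if σ i = σ j then Real.exp (-β) else 1) * pottsW q β G.edges σ := by
    exact pottsW_cons q β G.edges i j σ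
  refine this.trans ?_
  split_ifs <;> ring

lemma pottsA_nonneg (q : ℕ) (β : ℝ) (G : Multigraph) (i j : G.V) : 0 ≤ pottsA q β G i j := by
  apply Finset.sum_nonneg
  intro σ _
  apply mul_nonneg (pottsW_pos q β _ σ).le
  split_ifs <;> norm_num

lemma pottsA_le (q : ℕ) (β : ℝ) (G : Multigraph) (i j : G.V) :
    pottsA q β G i j ≤ pottsZ q β G := by
  apply Finset.sum_le_sum
  intro σ _
  have := (pottsW_pos q β G.edges σ).le
  split_ifs <;> linarith

/-- Schur powers of the collision matrix are positive semidefinite. -/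
lemma pottsA_pow_psd (q : ℕ) (β : ℝ) (G : Multigraph) (k : ℕ) : ∀ x : G.V → ℝ,
    0 ≤ ∑ i, ∑ j, pottsA q β G i j ^ k * x i * x j := by
  induction k with
  | zero =>
    intro x
    have : ∑ i, ∑ j, pottsA q β G i j ^ 0 * x i * x j = (∑ i, x i) * (∑ j, x j) := by
      rw [Finset.sum_mul_sum]
      simp
    rw [this]
    exact mul_self_nonneg _
  | succ k ih =>
    intro x
    have key : ∑ i, ∑ j, pottsA q β G i j ^ (k + 1) * x i * x j
        = ∑ σ : G.V → Fin q, ∑ s : Fin q, pottsW q β G.edges σ *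
          ∑ i, ∑ j, pottsA q β G i j ^ k * (if σ i = s then x i else 0)
            * (if σ j = s then x j else 0) := by
      have h1 : ∀ i j, pottsA q β G i j ^ (k + 1) * x i * x j
          = ∑ σ : G.V → Fin q, ∑ s : Fin q, pottsW q β G.edges σ *
            (pottsA q β G i j ^ k * (if σ i = s then x i else 0)
            * (if σ j = s then x j else 0)) := by
        intro i j
        have h2 : pottsA q β G i j ^ (k + 1) * x i * x j
          = ∑ σ : G.V → Fin q, (pottsW q β G.edges σ * (if σ i = σ j then 1 else 0))
            * (pottsA q β G i j ^ k * x i * x j) := by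
          rw [← Finset.sum_mul, pow_succ]
          change _ = pottsA q β G i j * _
          ring
        rw [h2]
        apply Finset.sum_congr rfl
        intro σ _
        rw [Finset.sum_eq_single (σ i)]
        · by_cases h : σ i = σ j
          · simp [h]
          · simp [h, Ne.symm h]
        · intro s _ hs
          simp [Ne.symm hs]
        · simp
      simp_rw [h1, Finset.mul_sum]
      calc _ = ∑ i, ∑ σ : G.V → Fin q, ∑ j, ∑ s : Fin q, pottsW q β G.edges σ *
            (pottsA q β G i j ^ k * (if σ i = s then x i else 0)
            * (if σ j = s then x j else 0)) :=
            Finset.sum_congr rfl fun i _ => Finset.sum_comm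
        _ = ∑ σ : G.V → Fin q, ∑ i, ∑ j, ∑ s : Fin q, pottsW q β G.edges σ *
            (pottsA q β G i j ^ k * (if σ i = s then x i else 0)
            * (if σ j = s then x j else 0)) := Finset.sum_comm
        _ = ∑ σ : G.V → Fin q, ∑ i, ∑ s : Fin q, ∑ j, pottsW q β G.edges σ *
            (pottsA q β G i j ^ k * (if σ i = s then x i else 0)
            * (if σ j = s then x j else 0)) :=
            Finset.sum_congr rfl fun σ _ => Finset.sum_congr rfl fun i _ => Finset.sum_comm
        _ = _ := Finset.sum_congr rfl fun σ _ => Finset.sum_comm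
    rw [key]
    exact Finset.sum_nonneg fun σ _ => Finset.sum_nonneg fun s _ =>
      mul_nonneg (pottsW_pos q β _ σ).le (ih fun i => if σ i = s then x i else 0)

theorem statement19 (q : ℕ) (hq : 2 ≤ q) (β : ℝ) (hβ : 0 ≤ β) (f : Multigraph → ℝ)
    (hf : ∀ G : Multigraph,
      f G = Real.log (∑ σ : G.V → Fin q,
        (G.edges.map (Sym2.lift
          ⟨fun i j => if σ i = σ j then Real.exp (-β) else 1,
            fun a b => by simp only [eq_comm]⟩)).prod)) :
    GraphParam.Invariant f ∧ GraphParam.Additive f ∧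
    GraphParam.Lipschitz f β ∧ GraphParam.Concave f ∧
    ∀ x : Fin q → ℝ, (∑ s, x s) = 0 →
      ∑ s : Fin q, ∑ t : Fin q,
        (if s = t then Real.exp (-β) else 1) * x s * x t ≤ 0 := by
  have hf' : ∀ G, f G = Real.log (pottsZ q β G) := hf
  have hZ := pottsZ_pos q hq β
  have he0 : 0 < Real.exp (-β) := Real.exp_pos _
  have he1 : Real.exp (-β) ≤ 1 := Real.exp_le_one_iff.2 (by linarith)
  have hA0 := pottsA_nonneg q β
  have hA1 := pottsA_le q β
  have hinc : ∀ (G : Multigraph) (i j : G.V), f (G.addEdge i j) - f G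
      = Real.log (1 - (1 - Real.exp (-β)) * pottsA q β G i j / pottsZ q β G) := by
    intro G i j
    have h0 := (hZ G).ne'
    rw [hf', hf', ← Real.log_div (hZ _).ne' h0, pottsZ_addEdge, sub_div, div_self h0]
  have hlow : ∀ (G : Multigraph) (i j : G.V),
      0 ≤ (1 - Real.exp (-β)) * pottsA q β G i j / pottsZ q β G :=
    fun G i j => div_nonneg (mul_nonneg (by linarith) (hA0 G i j)) (hZ G).le
  have hup : ∀ (G : Multigraph) (i j : G.V),
      (1 - Real.exp (-β)) * pottsA q β G i j / pottsZ q β G ≤ 1 - Real.exp (-β) := by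
    intro G i j
    rw [div_le_iff₀ (hZ G)]
    exact mul_le_mul_of_nonneg_left (hA1 G i j) (by linarith)
  refine ⟨?_, ?_, ?_, ?_, ?_⟩
  · intro G₁ G₂ e he
    rw [hf', hf']
    congr 1
    unfold pottsZ
    rw [he]
    symm
    refine Fintype.sum_equiv (Equiv.arrowCongr e.symm (Equiv.refl _)) _ _ ?_
    intro σ
    rw [pottsW_map]
    rfl
  · intro G₁ G₂
    rw [hf', hf', hf', ← Real.log_mul (hZ _).ne' (hZ _).ne']
    congr 1
    unfold pottsZ
    rw [Fintype.sum_mul_sum, ← Fintype.sum_prod_type' (fun (a : G₁.V → Fin q) (b : G₂.V → Fin q) =>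
      pottsW q β G₁.edges a * pottsW q β G₂.edges b)]
    let e : ((G₁.disjUnion G₂).V → Fin q) ≃ (G₁.V → Fin q) × (G₂.V → Fin q) :=
      Equiv.sumArrowEquivProdArrow G₁.V G₂.V (Fin q)
    refine Fintype.sum_equiv (M := ℝ) e _ _ ?_
    intro σ
    have key : ∀ τ : G₁.V ⊕ G₂.V → Fin q,
        pottsW q β (G₁.edges.map (Sym2.map Sum.inl) + G₂.edges.map (Sym2.map Sum.inr)) τ
          = pottsW q β G₁.edges (τ ∘ Sum.inl) * pottsW q β G₂.edges (τ ∘ Sum.inr) := by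
      intro τ
      rw [pottsW_add, pottsW_map, pottsW_map]
    exact key σ
  · intro G i j
    rw [hinc]
    have h1 := hlow G i j
    have h2 := hup G i j
    rw [abs_le]
    constructor
    · rw [Real.le_log_iff_exp_le (by linarith)]
      linarith
    · exact (Real.log_nonpos (by linarith) (by linarith)).trans hβ
  · intro G x _
    have hs : ∀ i j : G.V, HasSum (fun n : ℕ =>
        ((1 - Real.exp (-β)) * pottsA q β G i j / pottsZ q β G) ^ (n + 1) / ((n : ℝ) + 1)
          * x i * x j)
        (-(f (G.addEdge i j) - f G) * x i * x j) := by
      intro i j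
      rw [hinc]
      have h1 := hlow G i j
      have h2 := hup G i j
      refine ((Real.hasSum_pow_div_log_of_abs_lt_one ?_).mul_right (x i)).mul_right (x j)
      rw [abs_of_nonneg h1]
      linarith
    have hS := hasSum_sum (s := (Finset.univ : Finset G.V)) fun i _ =>
      hasSum_sum (s := (Finset.univ : Finset G.V)) fun j _ => hs i j
    have hnn := hS.nonneg (fun n => by
      have : ∑ i : G.V, ∑ j : G.V, ((1 - Real.exp (-β)) * pottsA q β G i j / pottsZ q β G) ^ (n + 1)
            / ((n : ℝ) + 1) * x i * x j
          = ((1 - Real.exp (-β)) / pottsZ q β G) ^ (n + 1) / ((n : ℝ) + 1)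
            * ∑ i, ∑ j, pottsA q β G i j ^ (n + 1) * x i * x j := by
        simp_rw [Finset.mul_sum]
        refine Finset.sum_congr rfl fun i _ => Finset.sum_congr rfl fun j _ => ?_
        rw [mul_div_right_comm, mul_pow]
        ring
      rw [this]
      refine mul_nonneg (div_nonneg (pow_nonneg (div_nonneg (by linarith) (hZ G).le) _)
        (by positivity)) (pottsA_pow_psd q β G (n + 1) x))
    simp only [neg_mul, Finset.sum_neg_distrib] at hnn
    linarith
  · intro x hx
    have h1 : ∀ s t : Fin q, (if s = t then Real.exp (-β) else 1) * x s * x t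
        = x s * x t - (if s = t then (1 - Real.exp (-β)) * (x s * x t) else 0) := by
      intro s t
      split_ifs <;> ring
    have h2 : ∑ s : Fin q, ∑ t : Fin q, (if s = t then Real.exp (-β) else 1) * x s * x t
        = (∑ s, x s) * (∑ t, x t) - ∑ s, (1 - Real.exp (-β)) * (x s * x s) := by
      simp_rw [h1, Finset.sum_sub_distrib]
      rw [Finset.sum_mul_sum]
      simp
    rw [h2, hx]
    have : 0 ≤ ∑ s, (1 - Real.exp (-β)) * (x s * x s) :=
      Finset.sum_nonneg fun s _ => mul_nonneg (by linarith) (mul_self_nonneg _)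
    linarith
end
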